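/- arXiv:2603.11217 — 2 statements merged into one kernel-verified Lean document; each statement's English description precedes it below -/
import Mathlib

section
/- (i) Let (X,d) be a metric space with dimH X < 1. Then for every ε > 0 there exist a metric space (Y,d') and a quasisymmetric homeomorphism f : X → Y with dimH Y ≤ ε. (ii) Let (X,d) be a totally bounded metric space with upper box-counting dimension dim_B X < 1. Then for every ε > 0 there exist a totally bounded metric space (Y,d') and a quasisymmetric homeomorphism f : X → Y with dim_B Y ≤ ε. -/
open Set Filter MeasureTheory Metric Topology
open scoped ENNReal NNReal

noncomputable section

/-- The maximal stretch `L_f(x,r) = sup {dist (f y) (f x) : y ∈ Ω, dist y x = r}`. -/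
def maxStretch {X Y : Type*} [MetricSpace X] [MetricSpace Y]
    (Ω : Set X) (f : X → Y) (x : X) (r : ℝ) : ℝ :=
  sSup ((fun y => dist (f y) (f x)) '' {y ∈ Ω | dist y x = r})

/-- The minimal stretch `ℓ_f(x,r) = inf {dist (f y) (f x) : y ∈ Ω, dist y x = r}`. -/
def minStretch {X Y : Type*} [MetricSpace X] [MetricSpace Y]
    (Ω : Set X) (f : X → Y) (x : X) (r : ℝ) : ℝ :=
  sInf ((fun y => dist (f y) (f x)) '' {y ∈ Ω | dist y x = r})

/-- `f` is a homeomorphism of `Ω` onto `Ω'`. -/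
def IsHomeoOn {X Y : Type*} [TopologicalSpace X] [TopologicalSpace Y]
    (f : X → Y) (Ω : Set X) (Ω' : Set Y) : Prop :=
  Set.BijOn f Ω Ω' ∧ ContinuousOn f Ω ∧
    ∃ g : Y → X, Set.InvOn g f Ω Ω' ∧ ContinuousOn g Ω'

/-- `f : Ω → Ω'` is a `K`-quasiconformal homeomorphism:
it is a homeomorphism of `Ω` onto `Ω'` and
`limsup_{r → 0⁺} L_f(x,r)/ℓ_f(x,r) ≤ K` for every `x ∈ Ω`. -/
def IsQCHomeoOn {X Y : Type*} [MetricSpace X] [MetricSpace Y]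
    (K : ℝ) (f : X → Y) (Ω : Set X) (Ω' : Set Y) : Prop :=
  IsHomeoOn f Ω Ω' ∧
    ∀ x ∈ Ω, Filter.limsup (fun r => maxStretch Ω f x r / minStretch Ω f x r)
      (𝓝[>] (0:ℝ)) ≤ K

/-- A domain: a nonempty open connected set. -/
def IsEuclDomain {X : Type*} [TopologicalSpace X] (Ω : Set X) : Prop :=
  IsOpen Ω ∧ IsConnected Ω

/-- The covering number `N(F,r)`: the minimal number of sets of diameter at most `r`
needed to cover `F`, as an extended nonnegative real. -/
def coverNumber {X : Type*} [MetricSpace X] (F : Set X) (r : ℝ) : ℝ≥0∞ :=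
  sInf { m : ℝ≥0∞ | ∃ (k : ℕ) (A : Fin k → Set X), m = (k : ℝ≥0∞) ∧
    (∀ i, Metric.diam (A i) ≤ r) ∧ F ⊆ ⋃ i, A i }

/-- The (regularized) `θ`-Assouad spectrum of a set `E`. -/
def assouadSpectrum {X : Type*} [MetricSpace X] (θ : ℝ) (E : Set X) : ℝ :=
  sInf { s : ℝ | 0 < s ∧ ∃ C : ℝ, 0 < C ∧ ∀ x ∈ E, ∀ R r : ℝ, 0 < r → r ≤ R ^ (1/θ) →
    R ^ (1/θ) < R → R < 1 →
    coverNumber (Metric.ball x R ∩ E) r ≤ ENNReal.ofReal (C * (R/r) ^ s) }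

/-- The upper box-counting dimension of a (totally bounded) metric space `X`. -/
def upperBoxDim (X : Type*) [MetricSpace X] : ℝ :=
  sInf { s : ℝ | 0 < s ∧ ∃ C : ℝ, 0 < C ∧ ∀ r : ℝ, 0 < r →
    r < Metric.diam (Set.univ : Set X) →
    coverNumber (Set.univ : Set X) r ≤ ENNReal.ofReal (C * r ^ (-s)) }

/-- The upper `θ`-intermediate dimension of a bounded set `E`. -/
def interDim {X : Type*} [MetricSpace X] (θ : ℝ) (E : Set X) : ℝ :=
  sInf { s : ℝ | 0 < s ∧ ∃ C : ℝ, 0 < C ∧ ∃ δ₀ : ℝ, 0 < δ₀ ∧ ∀ δ : ℝ, 0 < δ → δ < δ₀ →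
    ∃ (J : Finset ℕ) (A : ℕ → Set X), (E ⊆ ⋃ i ∈ J, A i) ∧
      (∀ i ∈ J, δ ^ (1/θ) ≤ Metric.diam (A i) ∧ Metric.diam (A i) ≤ δ) ∧
      (∑ i ∈ J, Metric.diam (A i) ^ s) ≤ C }

/-- `f` is a quasisymmetric map: there is an increasing homeomorphism
`η : [0,∞) → [0,∞)` such that `dist (f x) (f y) ≤ η t * dist (f x) (f z)`
whenever `dist x y ≤ t * dist x z`. -/
def IsQuasisymmetric {X Y : Type*} [MetricSpace X] [MetricSpace Y] (f : X → Y) : Prop :=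
  ∃ η : ℝ → ℝ, ContinuousOn η (Set.Ici 0) ∧ StrictMonoOn η (Set.Ici 0) ∧ η 0 = 0 ∧
    Set.SurjOn η (Set.Ici 0) (Set.Ici 0) ∧ Set.MapsTo η (Set.Ici 0) (Set.Ici 0) ∧
    ∀ x y z : X, ∀ t : ℝ, 0 < t → dist x y ≤ t * dist x z →
      dist (f x) (f y) ≤ η t * dist (f x) (f z)

/-- The maximal density of `μ` over the balls centred at `x` of radius at least `b`. -/
def maximalDensity {X : Type*} [MetricSpace X] [MeasurableSpace X] (μ : Measure X)
    (x : X) (b : ℝ) : ℝ :=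
  ⨆ t : Ici b, μ.real (closedBall x t) / t

section MaximalDensity

variable {X : Type*} [MetricSpace X] [MeasurableSpace X] {μ : Measure X}

lemma maximalDensity_le {b c : ℝ} {x : X}
    (h : ∀ t, b ≤ t → μ.real (closedBall x t) / t ≤ c) : maximalDensity μ x b ≤ c :=
  have : Nonempty (Ici b) := ⟨⟨b, self_mem_Ici⟩⟩
  ciSup_le fun t => h t t.2

lemma exists_lt_of_lt_maximalDensity {b c : ℝ} {x : X} (h : c < maximalDensity μ x b) :
    ∃ t, b ≤ t ∧ c < μ.real (closedBall x t) / t := by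
  contrapose! h
  exact maximalDensity_le h

variable [IsFiniteMeasure μ]

lemma measureReal_div_le_maximalDensity {b t : ℝ} (hb : 0 < b) (hbt : b ≤ t) (x : X) :
    μ.real (closedBall x t) / t ≤ maximalDensity μ x b := by
  have hbdd : BddAbove (range fun t : Ici b => μ.real (closedBall x t) / t) := by
    refine ⟨μ.real univ / b, ?_⟩
    rintro _ ⟨⟨t, ht⟩, rfl⟩
    exact div_le_div₀ measureReal_nonneg (measureReal_mono (subset_univ _)) hb ht
  exact le_ciSup hbdd ⟨t, hbt⟩

lemma measureReal_closedBall_le {b t : ℝ} (hb : 0 < b) (hbt : b ≤ t) (x : X) :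
    μ.real (closedBall x t) ≤ t * maximalDensity μ x b := by
  have h := measureReal_div_le_maximalDensity (μ := μ) hb hbt x
  rwa [div_le_iff₀' (hb.trans_le hbt)] at h

lemma maximalDensity_pos (hμ : μ ≠ 0) {b : ℝ} (hb : 0 < b) (x : X) :
    0 < maximalDensity μ x b := by
  obtain ⟨n, hn⟩ : ∃ n : ℕ, μ (closedBall x n) ≠ 0 := by
    by_contra! h
    refine hμ (Measure.measure_univ_eq_zero.1 ?_)
    rw [← iUnion_closedBall_nat x]
    exact measure_iUnion_null h
  have hmax : 0 < max b n := lt_max_of_lt_left hb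
  refine lt_of_lt_of_le ?_ (measureReal_div_le_maximalDensity hb (le_max_left b n) x)
  refine div_pos (ENNReal.toReal_pos ?_ (measure_ne_top _ _)) hmax
  exact fun h0 => hn (measure_mono_null (closedBall_subset_closedBall (le_max_right b n)) h0)

lemma maximalDensity_anti {b c : ℝ} (hb : 0 < b) (hbc : b ≤ c) (x : X) :
    maximalDensity μ x c ≤ maximalDensity μ x b :=
  maximalDensity_le fun _ ht => measureReal_div_le_maximalDensity hb (hbc.trans ht) x

lemma maximalDensity_le_mul_of_subset {x y : X} {b l : ℝ} (hb : 0 < b) (hl : 1 ≤ l)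
    (h : ∀ t, b ≤ t → closedBall x t ⊆ closedBall y (l * t)) :
    maximalDensity μ x b ≤ l * maximalDensity μ y (l * b) := by
  have hl0 : 0 < l := one_pos.trans_le hl
  refine maximalDensity_le fun t ht => ?_
  have ht0 := hb.trans_le ht
  rw [div_le_iff₀ ht0]
  calc μ.real (closedBall x t) ≤ μ.real (closedBall y (l * t)) := measureReal_mono (h t ht)
    _ ≤ l * t * maximalDensity μ y (l * b) :=
      measureReal_closedBall_le (by positivity) (by gcongr) y
    _ = _ := by ring

lemma maximalDensity_le_mul {b l : ℝ} (hb : 0 < b) (hl : 1 ≤ l) (x : X) :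
    maximalDensity μ x b ≤ l * maximalDensity μ x (l * b) :=
  maximalDensity_le_mul_of_subset hb hl fun _ ht =>
    closedBall_subset_closedBall (le_mul_of_one_le_left (hb.le.trans ht) hl)

lemma maximalDensity_le_two_mul {x y : X} {b : ℝ} (hb : 0 < b) (h : dist x y ≤ b) :
    maximalDensity μ x b ≤ 2 * maximalDensity μ y b := by
  refine (maximalDensity_le_mul_of_subset (y := y) hb one_le_two fun _ ht => ?_).trans ?_
  · exact closedBall_subset_closedBall' (by linarith)
  · gcongr
    exact maximalDensity_anti hb (by linarith) y

end MaximalDensity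

section Chains

variable {X : Type*} [MetricSpace X] [MeasurableSpace X] [BorelSpace X]
  {μ : Measure X} [IsFiniteMeasure μ]

/-- Disjoint balls near `x₀` of density larger than `40` times the maximal density of `μ` at `x₀`
and scale `R` have total radius at most `R / 20`. -/
lemma sum_radius_le_of_pairwiseDisjoint (hμ : μ ≠ 0) {ι : Type*} {x₀ : X} {R : ℝ} (hR : 0 < R)
    (J : Finset ι) (c : ι → X) (r : ι → ℝ) (hr : ∀ i ∈ J, 0 < r i)
    (hc : ∀ i ∈ J, dist x₀ (c i) ≤ R)
    (hd : (J : Set ι).PairwiseDisjoint fun i => closedBall (c i) (r i))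
    (hJ : ∀ i ∈ J, 40 * maximalDensity μ x₀ R < μ.real (closedBall (c i) (r i)) / r i) :
    ∑ i ∈ J, r i ≤ R / 20 := by
  have hv : 0 < maximalDensity μ x₀ R := maximalDensity_pos hμ hR x₀
  have hrR : ∀ i ∈ J, r i < R := by
    intro i hi
    by_contra! h
    have h1 := hJ i hi
    rw [lt_div_iff₀ (hr i hi)] at h1
    have h2 : μ.real (closedBall (c i) (r i)) ≤ 2 * r i * maximalDensity μ x₀ R := by
      refine (measureReal_mono ?_).trans (measureReal_closedBall_le hR (by linarith) x₀)
      refine closedBall_subset_closedBall' ?_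
      have := hc i hi
      rw [dist_comm] at this
      linarith
    nlinarith [mul_pos hv (hr i hi)]
  have hsum : ∑ i ∈ J, μ.real (closedBall (c i) (r i)) ≤ 2 * R * maximalDensity μ x₀ R := by
    rw [← measureReal_biUnion_finset hd fun i _ => measurableSet_closedBall]
    refine (measureReal_mono (iUnion₂_subset fun i hi => ?_)).trans
      (measureReal_closedBall_le hR (by linarith) x₀)
    refine closedBall_subset_closedBall' ?_
    have h1 := hc i hi
    rw [dist_comm] at h1
    linarith [hrR i hi]
  have hlow : 40 * maximalDensity μ x₀ R * ∑ i ∈ J, r i ≤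
      ∑ i ∈ J, μ.real (closedBall (c i) (r i)) := by
    rw [Finset.mul_sum]
    exact Finset.sum_le_sum fun i hi => ((lt_div_iff₀ (hr i hi)).1 (hJ i hi)).le
  have h3 : maximalDensity μ x₀ R * (∑ i ∈ J, r i) ≤ maximalDensity μ x₀ R * (R / 20) := by
    linarith
  exact le_of_mul_le_mul_left h3 hv

open scoped Classical in
/-- If the jumps in `P` connect `x₀` to distance `R`, then the jumps which see a density comparable
to the one at `x₀` have total length at least `R / 2`. -/
lemma half_le_sum_dist (hμ : μ ≠ 0) {x₀ : X} {R : ℝ} (hR : 0 < R) (P : Finset (X × X))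
    (hP : ∀ s, 0 ≤ s → s < R → ∃ q ∈ P, dist x₀ q.1 ≤ s ∧ s < dist x₀ q.2) :
    R / 2 ≤ ∑ q ∈ P with 0 < dist q.1 q.2 ∧
      maximalDensity μ q.1 (dist q.1 q.2) ≤ 40 * maximalDensity μ x₀ R, dist q.1 q.2 := by
  set v := maximalDensity μ x₀ R with hv
  set G := {q ∈ P | 0 < dist q.1 q.2 ∧ maximalDensity μ q.1 (dist q.1 q.2) ≤ 40 * v} with hG
  set B := {q ∈ P | dist x₀ q.1 ≤ R ∧ 0 < dist q.1 q.2 ∧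
    40 * v < maximalDensity μ q.1 (dist q.1 q.2)} with hB
  have hex : ∀ q ∈ B, ∃ t, dist q.1 q.2 ≤ t ∧ 40 * v < μ.real (closedBall q.1 t) / t :=
    fun q hq => exists_lt_of_lt_maximalDensity (Finset.mem_filter.1 hq).2.2.2
  choose! r hrd hrv using hex
  have hr0 : ∀ q ∈ B, 0 < r q := fun q hq => (Finset.mem_filter.1 hq).2.2.1.trans_le (hrd q hq)
  obtain ⟨u, huB, hud, hu⟩ := Vitali.exists_disjoint_subfamily_covering_enlargement_closedBall
    (B : Set (X × X)) Prod.fst r (∑ q ∈ B, r q)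
    (fun q hq => Finset.single_le_sum (f := r) (fun i hi => (hr0 i hi).le) hq) 5 (by norm_num)
  lift u to Finset (X × X) using B.finite_toSet.subset huB
  have huB' : ∀ q ∈ u, q ∈ B := fun q hq => huB hq
  have hsum : ∑ q ∈ u, r q ≤ R / 20 :=
    sum_radius_le_of_pairwiseDisjoint hμ hR u Prod.fst r (fun i hi => hr0 i (huB' i hi))
      (fun i hi => (Finset.mem_filter.1 (huB' i hi)).2.1) hud fun i hi => hrv i (huB' i hi)
  have hcover : Ico 0 R ⊆ (⋃ q ∈ G, Ico (dist x₀ q.1) (dist x₀ q.2)) ∪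
      ⋃ q ∈ u, Icc (dist x₀ q.1 - 5 * r q) (dist x₀ q.1 + 5 * r q) := by
    rintro s ⟨hs0, hsR⟩
    obtain ⟨q, hqP, hq1, hq2⟩ := hP s hs0 hsR
    have hdq : 0 < dist q.1 q.2 := by
      linarith [dist_triangle x₀ q.1 q.2]
    by_cases hq : maximalDensity μ q.1 (dist q.1 q.2) ≤ 40 * v
    · exact Or.inl (mem_iUnion₂.2 ⟨q, Finset.mem_filter.2 ⟨hqP, hdq, hq⟩, hq1, hq2⟩)
    · have hqB : q ∈ B := Finset.mem_filter.2 ⟨hqP, by linarith, hdq, not_le.1 hq⟩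
      obtain ⟨j, hju, hj⟩ := hu q hqB
      refine Or.inr (mem_iUnion₂.2 ⟨j, hju, ?_⟩)
      have h1 : dist q.1 j.1 ≤ 5 * r j :=
        mem_closedBall.1 (hj (mem_closedBall_self (hr0 q hqB).le))
      have h2 : dist q.2 j.1 ≤ 5 * r j := by
        refine mem_closedBall.1 (hj (mem_closedBall.2 ?_))
        rw [dist_comm]
        exact hrd q hqB
      have h3 := dist_triangle_right x₀ j.1 q.1
      have h4 := dist_triangle x₀ j.1 q.2
      have h5 := dist_comm j.1 q.2
      have h6 := dist_comm j.1 q.1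
      constructor <;> linarith
  have hvol : ENNReal.ofReal R ≤ ENNReal.ofReal (∑ q ∈ G, dist q.1 q.2 + 10 * ∑ q ∈ u, r q) := by
    calc ENNReal.ofReal R = volume (Ico (0 : ℝ) R) := by simp
      _ ≤ volume (⋃ q ∈ G, Ico (dist x₀ q.1) (dist x₀ q.2)) +
          volume (⋃ q ∈ u, Icc (dist x₀ q.1 - 5 * r q) (dist x₀ q.1 + 5 * r q)) :=
        (measure_mono hcover).trans (measure_union_le _ _)
      _ ≤ ∑ q ∈ G, ENNReal.ofReal (dist q.1 q.2) + ∑ q ∈ u, ENNReal.ofReal (10 * r q) := by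
        refine add_le_add ((measure_biUnion_finset_le _ _).trans ?_)
          ((measure_biUnion_finset_le _ _).trans ?_)
        · refine Finset.sum_le_sum fun q _ => ?_
          rw [Real.volume_Ico]
          exact ENNReal.ofReal_le_ofReal (by linarith [dist_triangle x₀ q.1 q.2])
        · refine Finset.sum_le_sum fun q _ => ?_
          rw [Real.volume_Icc]
          exact ENNReal.ofReal_le_ofReal (by linarith)
      _ = _ := by
        rw [← ENNReal.ofReal_sum_of_nonneg fun _ _ => dist_nonneg,
          ← ENNReal.ofReal_sum_of_nonneg fun q hq => by linarith [hr0 q (huB' q hq)],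
          ← ENNReal.ofReal_add (Finset.sum_nonneg fun _ _ => dist_nonneg)
            (Finset.sum_nonneg fun q hq => by linarith [hr0 q (huB' q hq)]), Finset.mul_sum]
  have hnn : 0 ≤ ∑ q ∈ G, dist q.1 q.2 + 10 * ∑ q ∈ u, r q :=
    add_nonneg (Finset.sum_nonneg fun _ _ => dist_nonneg)
      (mul_nonneg (by norm_num) (Finset.sum_nonneg fun q hq => (hr0 q (huB' q hq)).le))
  have := (ENNReal.ofReal_le_ofReal_iff hnn).1 hvol
  linarith

end Chains

/-- The length of a jump from `x` to `y`, deflated where the measure `μ` is concentrated. -/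
def jumpCost {X : Type*} [MetricSpace X] [MeasurableSpace X] (μ : Measure X) (p : ℕ)
    (x y : X) : ℝ :=
  dist x y / min (maximalDensity μ x (dist x y)) (maximalDensity μ y (dist x y)) ^ p

lemma exists_mem_zip_le_lt {X : Type*} (u : X → ℝ) (s : ℝ) (l : List X) (x y : X)
    (hx : u x ≤ s) (hy : s < u y) :
    ∃ q ∈ (x :: l).zip (l ++ [y]), u q.1 ≤ s ∧ s < u q.2 := by
  induction l generalizing x with
  | nil => exact ⟨(x, y), by simp, hx, hy⟩
  | cons a l ih =>
    by_cases ha : s < u a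
    · exact ⟨(x, a), by simp, hx, ha⟩
    · obtain ⟨q, hq, h⟩ := ih a (not_lt.1 ha)
      exact ⟨q, List.mem_cons_of_mem _ hq, h⟩

lemma sum_toFinset_le_sum_map {α : Type*} [DecidableEq α] (l : List α) (f : α → ℝ≥0) :
    ∑ a ∈ l.toFinset, f a ≤ (l.map f).sum := by
  have h : l.toFinset = l.dedup.toFinset := by ext; simp
  rw [h, List.sum_toFinset f l.nodup_dedup]
  exact (l.dedup_sublist.map f).sum_le_sum fun _ _ => zero_le

section JumpCost

variable {X : Type*} [MetricSpace X] [MeasurableSpace X] {μ : Measure X}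

lemma jumpCost_comm (p : ℕ) (x y : X) : jumpCost μ p x y = jumpCost μ p y x := by
  rw [jumpCost, jumpCost, dist_comm, min_comm]

lemma jumpCost_self (p : ℕ) (x : X) : jumpCost μ p x x = 0 := by
  simp [jumpCost]

variable [IsFiniteMeasure μ]

lemma min_maximalDensity_pos (hμ : μ ≠ 0) {b : ℝ} (hb : 0 < b) (x y : X) :
    0 < min (maximalDensity μ x b) (maximalDensity μ y b) :=
  lt_min (maximalDensity_pos hμ hb x) (maximalDensity_pos hμ hb y)

lemma jumpCost_nonneg (hμ : μ ≠ 0) (p : ℕ) (x y : X) : 0 ≤ jumpCost μ p x y := by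
  rcases eq_or_ne x y with rfl | hxy
  · exact (jumpCost_self p x).ge
  · exact div_nonneg dist_nonneg (pow_nonneg (min_maximalDensity_pos hμ (dist_pos.2 hxy) x y).le p)

lemma jumpCost_le (hμ : μ ≠ 0) (p : ℕ) (x y : X) :
    jumpCost μ p x y ≤ 2 ^ p * (dist x y / maximalDensity μ x (dist x y) ^ p) := by
  rcases eq_or_ne x y with rfl | hxy
  · simp [jumpCost]
  have hd := dist_pos.2 hxy
  have hv := maximalDensity_pos hμ hd x
  have hmin : maximalDensity μ x (dist x y) / 2 ≤
      min (maximalDensity μ x (dist x y)) (maximalDensity μ y (dist x y)) :=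
    le_min (by linarith) (by linarith [maximalDensity_le_two_mul (μ := μ) hd (le_refl (dist x y))])
  calc jumpCost μ p x y ≤ dist x y / (maximalDensity μ x (dist x y) / 2) ^ p := by
        unfold jumpCost; gcongr
    _ = _ := by rw [div_pow]; field_simp

lemma le_jumpCost (hμ : μ ≠ 0) (p : ℕ) {x y : X} {c : ℝ} (hxy : 0 < dist x y)
    (h : maximalDensity μ x (dist x y) ≤ c) : dist x y / c ^ p ≤ jumpCost μ p x y := by
  have hmin := min_maximalDensity_pos hμ hxy x y
  unfold jumpCost
  gcongr
  exact (min_le_left _ _).trans h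

lemma le_sum_zipWith_jumpCost [BorelSpace X] (hμ : μ ≠ 0) (p : ℕ) (x y : X)
    (d : X → X → ℝ≥0) (hd : ∀ x y, (d x y : ℝ) = jumpCost μ p x y) (l : List X) :
    dist x y / (2 * (40 * maximalDensity μ x (dist x y)) ^ p) ≤
      (((x :: l).zipWith d (l ++ [y])).sum : ℝ≥0) := by
  classical
  rcases eq_or_ne x y with rfl | hxy
  · simp
  have hR := dist_pos.2 hxy
  have hv := maximalDensity_pos hμ hR x
  set L := (x :: l).zip (l ++ [y]) with hL
  have hsum : (x :: l).zipWith d (l ++ [y]) = L.map fun q => d q.1 q.2 := by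
    rw [hL, List.map_zip_eq_zipWith]
    rfl
  have h := half_le_sum_dist hμ hR L.toFinset fun s hs0 hsR => by
    simpa using exists_mem_zip_le_lt (fun z => dist x z) s l x y (by simpa using hs0) hsR
  calc dist x y / (2 * (40 * maximalDensity μ x (dist x y)) ^ p)
      = dist x y / 2 / (40 * maximalDensity μ x (dist x y)) ^ p := by rw [div_div]
    _ ≤ (∑ q ∈ L.toFinset with 0 < dist q.1 q.2 ∧ maximalDensity μ q.1 (dist q.1 q.2) ≤
          40 * maximalDensity μ x (dist x y), dist q.1 q.2) /
          (40 * maximalDensity μ x (dist x y)) ^ p := by gcongr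
    _ ≤ ∑ q ∈ L.toFinset with 0 < dist q.1 q.2 ∧ maximalDensity μ q.1 (dist q.1 q.2) ≤
          40 * maximalDensity μ x (dist x y), (d q.1 q.2 : ℝ) := by
        rw [Finset.sum_div]
        refine Finset.sum_le_sum fun q hq => ?_
        rw [hd]
        exact le_jumpCost hμ p (Finset.mem_filter.1 hq).2.1 (Finset.mem_filter.1 hq).2.2
    _ ≤ ∑ q ∈ L.toFinset, (d q.1 q.2 : ℝ) :=
        Finset.sum_le_sum_of_subset_of_nonneg (Finset.filter_subset _ _)
          fun _ _ _ => NNReal.coe_nonneg _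
    _ ≤ _ := by
        rw [hsum]
        exact_mod_cast sum_toFinset_le_sum_map L fun q => d q.1 q.2

end JumpCost

/-- A cost function whose chain sums are bounded below by a positive function is comparable to a
metric. -/
lemma exists_equiv_le_dist_le {X : Type} (d : X → X → ℝ≥0) (hself : ∀ x, d x x = 0)
    (hcomm : ∀ x y, d x y = d y x) (c : X → X → ℝ) (hc : ∀ x y, x ≠ y → 0 < c x y)
    (hcd : ∀ x y l, c x y ≤ (((x :: l).zipWith d (l ++ [y])).sum : ℝ≥0)) :
    ∃ (Y : Type) (_ : MetricSpace Y) (f : X ≃ Y),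
      (∀ x y, dist (f x) (f y) ≤ d x y) ∧ ∀ x y, c x y ≤ dist (f x) (f y) := by
  let m : PseudoMetricSpace X := PseudoMetricSpace.ofPreNNDist d hself hcomm
  have hlow : ∀ x y, c x y ≤ dist x y := by
    intro x y
    rw [PseudoMetricSpace.dist_ofPreNNDist, NNReal.coe_iInf]
    exact le_ciInf fun l => hcd x y l
  let m' : MetricSpace X := MetricSpace.mk fun {x y} hxy => by
    by_contra hne
    exact ((hc x y hne).trans_le (hlow x y)).ne' hxy
  exact ⟨X, m', Equiv.refl X, PseudoMetricSpace.dist_ofPreNNDist_le d hself hcomm, hlow⟩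

/-- The metric of `X` can be deflated by a power of the maximal density of `μ`. -/
lemma exists_equiv_dist_comparable {X : Type} [MetricSpace X] [MeasurableSpace X] [BorelSpace X]
    {μ : Measure X} [IsFiniteMeasure μ] (hμ : μ ≠ 0) (p : ℕ) :
    ∃ (Y : Type) (_ : MetricSpace Y) (f : X ≃ Y),
      (∀ x y, dist (f x) (f y) ≤ 2 ^ p * (dist x y / maximalDensity μ x (dist x y) ^ p)) ∧
      ∀ x y, dist x y / (2 * (40 * maximalDensity μ x (dist x y)) ^ p) ≤ dist (f x) (f y) := by
  obtain ⟨Y, mY, f, hle, hge⟩ := exists_equiv_le_dist_le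
    (fun x y => ⟨jumpCost μ p x y, jumpCost_nonneg hμ p x y⟩)
    (fun x => NNReal.eq (jumpCost_self p x)) (fun x y => NNReal.eq (jumpCost_comm p x y))
    (fun x y => dist x y / (2 * (40 * maximalDensity μ x (dist x y)) ^ p))
    (fun x y hne => by
      have hpos := dist_pos.2 hne
      have hv := maximalDensity_pos hμ hpos x
      positivity)
    (fun x y l => le_sum_zipWith_jumpCost hμ p x y _ (fun _ _ => rfl) l)
  exact ⟨Y, mY, f, fun x y => (hle x y).trans (jumpCost_le hμ p x y), hge⟩

lemma surjOn_Ici_of_continuousOn {η : ℝ → ℝ} (hη : ContinuousOn η (Ici 0)) (h0 : η 0 = 0)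
    {c : ℝ} (hc : 0 < c) (h : ∀ t, 0 ≤ t → c * t ≤ η t) : SurjOn η (Ici 0) (Ici 0) := by
  intro y hy
  have hy0 : 0 ≤ y / c := div_nonneg hy hc.le
  have hy1 : y ≤ η (y / c) := by simpa [mul_div_cancel₀ _ hc.ne'] using h _ hy0
  obtain ⟨t, ht, rfl⟩ := intermediate_value_Icc hy0 (hη.mono Icc_subset_Ici_self)
    ⟨h0.trans_le hy, hy1⟩
  exact ⟨t, ht.1, rfl⟩

lemma isQuasisymmetric_of_le_mul_pow {X Y : Type*} [MetricSpace X] [MetricSpace Y] {f : X → Y}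
    {C : ℝ} (hC : 0 < C) (p : ℕ)
    (h : ∀ x y z t, 0 < t → dist x y ≤ t * dist x z →
      dist (f x) (f y) ≤ C * t * (1 + t) ^ p * dist (f x) (f z)) : IsQuasisymmetric f := by
  have hcont : ContinuousOn (fun t : ℝ => C * t * (1 + t) ^ p) (Ici 0) := by fun_prop
  refine ⟨fun t => C * t * (1 + t) ^ p, hcont, ?_, by simp, ?_, ?_, h⟩
  · intro a ha b hb hab
    have ha : 0 ≤ a := ha
    have hb : 0 < b := ha.trans_lt hab
    have h1 : C * a < C * b := by gcongr
    have h2 : (1 + a) ^ p ≤ (1 + b) ^ p := by gcongr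
    exact mul_lt_mul h1 h2 (by positivity) (by positivity)
  · refine surjOn_Ici_of_continuousOn hcont (by simp) hC fun t ht => ?_
    exact le_mul_of_one_le_right (by positivity) (one_le_pow₀ (by linarith))
  · intro t ht
    have ht : 0 ≤ t := ht
    exact mem_Ici.2 (by positivity)

lemma isQuasisymmetric_id {X : Type*} [MetricSpace X] : IsQuasisymmetric (id : X → X) :=
  isQuasisymmetric_of_le_mul_pow one_pos 0 fun x y z t _ h => by simpa using h

lemma isHomeoOn_univ {X Y : Type*} [TopologicalSpace X] [TopologicalSpace Y] (f : X ≃ Y)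
    (hf : Continuous f) (hf' : Continuous f.symm) : IsHomeoOn f univ univ :=
  ⟨bijOn_univ.2 f.bijective, hf.continuousOn, f.symm,
    ⟨f.leftInverse_symm.leftInvOn _, f.rightInverse_symm.rightInvOn _⟩, hf'.continuousOn⟩

/-- Any finite nonzero measure `μ` on `X` yields a quasisymmetric homeomorphism which contracts the
balls having a large `μ`-density. -/
theorem exists_isQuasisymmetric_dist_le {X : Type} [MetricSpace X] [MeasurableSpace X]
    [BorelSpace X] {μ : Measure X} [IsFiniteMeasure μ] (hμ : μ ≠ 0) (p : ℕ) :
    ∃ (Y : Type) (_ : MetricSpace Y) (f : X → Y), IsHomeoOn f univ univ ∧ IsQuasisymmetric f ∧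
      ∀ x y r, 0 < r → dist x y ≤ r → 0 < μ.real (closedBall x r) →
        dist (f x) (f y) ≤ 2 ^ p * (dist x y * (r / μ.real (closedBall x r)) ^ p) := by
  obtain ⟨Y, mY, f, hle, hge⟩ := exists_equiv_dist_comparable hμ p
  have hball : ∀ x y r, 0 < r → dist x y ≤ r → 0 < μ.real (closedBall x r) →
      dist (f x) (f y) ≤ 2 ^ p * (dist x y * (r / μ.real (closedBall x r)) ^ p) := by
    intro x y r hr hxy hμr
    rcases eq_or_ne x y with rfl | hne
    · simp
    have hd := dist_pos.2 hne
    have h1 : μ.real (closedBall x r) / r ≤ maximalDensity μ x (dist x y) :=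
      measureReal_div_le_maximalDensity hd hxy x
    have h2 : 0 < μ.real (closedBall x r) / r := by positivity
    refine (hle x y).trans ?_
    rw [← inv_div (μ.real (closedBall x r)), inv_pow, ← div_eq_mul_inv]
    gcongr
  refine ⟨Y, mY, f, isHomeoOn_univ f ?_ ?_, ?_, hball⟩
  · refine Metric.continuous_iff.2 fun x ε hε => ?_
    have hv := maximalDensity_pos hμ one_pos x
    set K := 2 ^ p * (1 / maximalDensity μ x 1 ^ p) with hK
    have hK0 : 0 < K := by positivity
    refine ⟨min 1 (ε / K), by positivity, fun y hy => ?_⟩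
    rw [dist_comm] at hy ⊢
    rcases eq_or_ne x y with rfl | hne
    · simpa using hε
    have hd := dist_pos.2 hne
    have h1 : maximalDensity μ x 1 ≤ maximalDensity μ x (dist x y) :=
      maximalDensity_anti hd (hy.le.trans (min_le_left _ _)) x
    calc dist (f x) (f y) ≤ 2 ^ p * (dist x y / maximalDensity μ x (dist x y) ^ p) := hle x y
      _ ≤ 2 ^ p * (dist x y / maximalDensity μ x 1 ^ p) := by gcongr
      _ = dist x y * K := by rw [hK]; ring
      _ < ε / K * K := by gcongr; exact hy.trans_le (min_le_right _ _)
      _ = ε := div_mul_cancel₀ _ hK0.ne'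
  · refine Metric.continuous_iff.2 fun y ε hε => ?_
    have hv := maximalDensity_pos hμ hε (f.symm y)
    refine ⟨ε / (2 * (40 * maximalDensity μ (f.symm y) ε) ^ p), by positivity, fun z hz => ?_⟩
    by_contra! h
    rw [dist_comm] at hz h
    refine hz.not_ge ?_
    have h1 := hge (f.symm y) (f.symm z)
    have h2 := maximalDensity_anti (μ := μ) hε h (f.symm y)
    have h3 := maximalDensity_pos hμ (hε.trans_le h) (f.symm y)
    rw [f.apply_symm_apply, f.apply_symm_apply] at h1
    refine le_trans ?_ h1
    gcongr
  · refine isQuasisymmetric_of_le_mul_pow (C := 2 * 80 ^ p) (by positivity) p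
      fun x y z t ht hxy => ?_
    rcases eq_or_ne x y with rfl | hne
    · rw [dist_self]; positivity
    have ha := dist_pos.2 hne
    have hb : 0 < dist x z := pos_of_mul_pos_right (ha.trans_le hxy) ht.le
    have hva := maximalDensity_pos hμ ha x
    have hvb := maximalDensity_pos hμ hb x
    have h1 : maximalDensity μ x (dist x z) ≤ (1 + t) * maximalDensity μ x (dist x y) :=
      (maximalDensity_le_mul (l := 1 + t) hb (by linarith) x).trans <| by
        gcongr
        exact maximalDensity_anti ha (by linarith) x
    set va := maximalDensity μ x (dist x y)
    set vb := maximalDensity μ x (dist x z)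
    have h2 : (va ^ p)⁻¹ ≤ (1 + t) ^ p * (vb ^ p)⁻¹ := by
      rw [← div_eq_mul_inv, ← div_pow, ← inv_pow]
      gcongr
      rw [inv_le_comm₀ hva (by positivity), inv_div, div_le_iff₀' (by positivity)]
      exact h1
    calc dist (f x) (f y) ≤ 2 ^ p * (dist x y * (va ^ p)⁻¹) := hle x y
      _ ≤ 2 ^ p * (t * dist x z * ((1 + t) ^ p * (vb ^ p)⁻¹)) := by gcongr
      _ = 2 * 80 ^ p * t * (1 + t) ^ p * (dist x z / (2 * (40 * vb) ^ p)) := by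
        rw [show (80 : ℝ) = 2 * 40 by norm_num, mul_pow, mul_pow]
        field_simp
      _ ≤ 2 * 80 ^ p * t * (1 + t) ^ p * dist (f x) (f z) := by
        gcongr
        exact hge x z

/-- Sets `A i` of size `r i` with `∑ r i ^ s < ∞` can be contracted simultaneously to size
comparable to `r i ^ (1 + p * (1 - s))` by a quasisymmetric homeomorphism. -/
theorem exists_isQuasisymmetric_of_tsum_ne_top {X : Type} [MetricSpace X] [Nonempty X]
    {ι : Type*} [Nonempty ι] (A : ι → Set X) (r : ι → ℝ) (hr : ∀ i, 0 < r i)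
    (hA : ∀ i, ∀ x ∈ A i, ∀ y ∈ A i, dist x y ≤ r i) (s : ℝ)
    (hs : ∑' i, ENNReal.ofReal (r i ^ s) ≠ ∞) (p : ℕ) :
    ∃ (Y : Type) (_ : MetricSpace Y) (f : X → Y), IsHomeoOn f univ univ ∧ IsQuasisymmetric f ∧
      (TotallyBounded (univ : Set X) → TotallyBounded (univ : Set Y)) ∧
      ∀ i, ∀ x ∈ A i, ∀ y ∈ A i, dist (f x) (f y) ≤ 2 ^ p * r i ^ (1 + p * (1 - s)) := by
  classical
  let : MeasurableSpace X := borel X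
  have : BorelSpace X := ⟨rfl⟩
  have hex : ∀ i, ∃ c, (A i).Nonempty → c ∈ A i := fun i => by
    by_cases h : (A i).Nonempty
    · exact ⟨h.choose, fun _ => h.choose_spec⟩
    · exact ⟨Classical.arbitrary X, fun h' => absurd h' h⟩
  choose c hc using hex
  let μ : Measure X := Measure.sum fun i => ENNReal.ofReal (r i ^ s) • Measure.dirac (c i)
  have hμuniv : μ univ = ∑' i, ENNReal.ofReal (r i ^ s) := by
    simp [μ, Measure.sum_apply _ MeasurableSet.univ]
  have : IsFiniteMeasure μ := ⟨by rw [hμuniv]; exact hs.lt_top⟩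
  have hmass : ∀ i (S : Set X), MeasurableSet S → c i ∈ S → r i ^ s ≤ μ.real S := by
    intro i S hS hi
    refine (ENNReal.ofReal_le_iff_le_toReal (measure_ne_top _ _)).1 ?_
    rw [Measure.sum_apply _ hS]
    refine le_trans ?_ (ENNReal.le_tsum i)
    simp [Measure.dirac_apply' _ hS, hi]
  have hμ : μ ≠ 0 := by
    intro h0
    have h1 := hmass (Classical.arbitrary ι) univ MeasurableSet.univ (mem_univ _)
    have h2 := Real.rpow_pos_of_pos (hr (Classical.arbitrary ι)) s
    rw [h0] at h1
    simp at h1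
    linarith
  obtain ⟨Y, mY, f, hf, hqs, hball⟩ := exists_isQuasisymmetric_dist_le hμ p
  refine ⟨Y, mY, f, hf, hqs, fun htb => ?_, fun i x hx y hy => ?_⟩
  · set D := Metric.diam (univ : Set X) + 1 with hD
    have hD0 : 0 < D := by have := Metric.diam_nonneg (s := (univ : Set X)); linarith
    have hdist : ∀ x y : X, dist x y ≤ D := fun x y => by
      have := dist_le_diam_of_mem htb.isBounded (mem_univ x) (mem_univ y)
      linarith
    have huniv : ∀ x : X, closedBall x D = univ := fun x =>
      eq_univ_of_forall fun y => mem_closedBall.2 (hdist y x)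
    have hpos : 0 < μ.real univ :=
      ENNReal.toReal_pos (Measure.measure_univ_ne_zero.2 hμ) (measure_ne_top _ _)
    have hlip : LipschitzWith (Real.toNNReal (2 ^ p * (D / μ.real univ) ^ p)) f := by
      refine LipschitzWith.of_dist_le_mul fun x y => ?_
      rw [Real.coe_toNNReal _ (by positivity)]
      have := hball x y D hD0 (hdist x y) (by rwa [huniv])
      rw [huniv] at this
      linarith
    rw [← hf.1.image_eq]
    exact htb.image hlip.uniformContinuous
  · have hri := hr i
    have hs0 := Real.rpow_pos_of_pos hri s
    have hm := hmass i (closedBall x (r i)) measurableSet_closedBall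
      (mem_closedBall.2 (hA i _ (hc i ⟨x, hx⟩) x hx))
    refine (hball x y (r i) hri (hA i x hx y hy) (hs0.trans_le hm)).trans ?_
    gcongr
    calc dist x y * (r i / μ.real (closedBall x (r i))) ^ p ≤ r i * (r i / r i ^ s) ^ p := by
          gcongr
          exact hA i x hx y hy
      _ = r i ^ (1 + p * (1 - s)) := by
          rw [Real.rpow_add hri, Real.rpow_one, mul_comm (p : ℝ), Real.rpow_mul hri.le,
            Real.rpow_natCast, Real.rpow_sub hri, Real.rpow_one]

/-- A set of vanishing `s`-dimensional Hausdorff measure has coverings of small `s`-content. -/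
lemma exists_cover_tsum_rpow_le {X : Type*} [MetricSpace X] [MeasurableSpace X] [BorelSpace X]
    {s : ℝ} (hs : 0 < s) (h : μH[s] (univ : Set X) = 0) {δ : ℝ≥0∞} (hδ : δ ≠ 0) :
    ∃ (A : ℕ → Set X) (r : ℕ → ℝ), (∀ k, 0 < r k) ∧
      (∀ k, ∀ x ∈ A k, ∀ y ∈ A k, dist x y ≤ r k) ∧ univ ⊆ ⋃ k, A k ∧
      ∑' k, ENNReal.ofReal (r k ^ s) ≤ δ := by
  have hδ2 : δ / 2 ≠ 0 := (ENNReal.half_pos hδ).ne'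
  rw [Measure.hausdorffMeasure_apply] at h
  have h1 := (ENNReal.iSup_eq_zero.1 ((ENNReal.iSup_eq_zero.1 h) 1)) one_pos
  have h2 := h1.trans_lt hδ2.bot_lt
  simp only [iInf_lt_iff] at h2
  obtain ⟨A, hAc, hA1, hAsum⟩ := h2
  obtain ⟨e, he0, hesum⟩ := ENNReal.exists_pos_sum_of_countable hδ2 ℕ
  have hfin : ∀ k, ediam (A k) ≠ ∞ := fun k => ((hA1 k).trans_lt ENNReal.one_lt_top).ne
  refine ⟨A, fun k => max (ediam (A k)).toReal ((e k : ℝ) ^ s⁻¹), fun k => ?_, ?_, hAc, ?_⟩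
  · exact lt_max_of_lt_right (Real.rpow_pos_of_pos (NNReal.coe_pos.2 (he0 k)) _)
  · intro k x hx y hy
    refine le_max_of_le_left ?_
    rw [dist_edist]
    exact ENNReal.toReal_mono (hfin k) (edist_le_ediam_of_mem hx hy)
  · calc ∑' k, ENNReal.ofReal (max (ediam (A k)).toReal ((e k : ℝ) ^ s⁻¹) ^ s)
        ≤ ∑' k, ((⨆ _ : (A k).Nonempty, ediam (A k) ^ s) + (e k : ℝ≥0∞)) := by
          refine ENNReal.tsum_le_tsum fun k => ?_
          rcases max_choice (ediam (A k)).toReal ((e k : ℝ) ^ s⁻¹) with h | h <;> rw [h]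
          · refine le_add_right ?_
            rw [← ENNReal.ofReal_rpow_of_nonneg ENNReal.toReal_nonneg hs.le,
              ENNReal.ofReal_toReal (hfin k)]
            rcases (A k).eq_empty_or_nonempty with h0 | h0
            · simp [h0, hs]
            · simp [h0]
          · refine le_add_left ?_
            rw [← Real.rpow_mul (NNReal.coe_nonneg _), inv_mul_cancel₀ hs.ne', Real.rpow_one,
              ENNReal.ofReal_coe_nnreal]
      _ ≤ δ / 2 + δ / 2 := by
          rw [ENNReal.tsum_add]
          exact add_le_add hAsum.le hesum.le
      _ = δ := ENNReal.add_halves δ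

lemma exists_nat_le_mul_one_add_mul {s t ε : ℝ} (hs : s < 1) (hε : 0 < ε) :
    ∃ p : ℕ, t ≤ ε * (1 + p * (1 - s)) := by
  obtain ⟨p, hp⟩ := exists_nat_ge (t / (ε * (1 - s)))
  have h1 : 0 < 1 - s := by linarith
  refine ⟨p, ?_⟩
  rw [div_le_iff₀ (by positivity)] at hp
  linarith

theorem exists_isQuasisymmetric_dimH_le {X : Type} [MetricSpace X]
    (hX : dimH (univ : Set X) < 1) {ε : ℝ} (hε : 0 < ε) :
    ∃ (Y : Type) (_ : MetricSpace Y) (f : X → Y), IsHomeoOn f univ univ ∧ IsQuasisymmetric f ∧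
      dimH (univ : Set Y) ≤ ENNReal.ofReal ε := by
  rcases isEmpty_or_nonempty X with hX0 | hX0
  · refine ⟨X, inferInstance, id, isHomeoOn_univ (Equiv.refl X) continuous_id continuous_id,
      isQuasisymmetric_id, ?_⟩
    rw [univ_eq_empty_iff.2 hX0, dimH_empty]
    exact zero_le
  let : MeasurableSpace X := borel X
  have : BorelSpace X := ⟨rfl⟩
  obtain ⟨s, hXs, hs1⟩ := ENNReal.lt_iff_exists_nnreal_btwn.1 hX
  have hs0 : 0 < (s : ℝ) := by
    have : (0 : ℝ≥0∞) < s := zero_le.trans_lt hXs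
    exact_mod_cast this
  have hs1 : (s : ℝ) < 1 := by exact_mod_cast hs1
  choose A r hr hA hAc hAsum using fun n : ℕ => exists_cover_tsum_rpow_le hs0
    (hausdorffMeasure_of_dimH_lt hXs) (δ := 2⁻¹ ^ n) (pow_ne_zero n (by simp))
  obtain ⟨p, hp⟩ := exists_nat_le_mul_one_add_mul (t := s) hs1 hε
  have hsum : ∑' i : ℕ × ℕ, ENNReal.ofReal (r i.1 i.2 ^ (s : ℝ)) ≠ ∞ := by
    rw [ENNReal.tsum_prod (f := fun n k => ENNReal.ofReal (r n k ^ (s : ℝ)))]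
    refine ((ENNReal.tsum_le_tsum hAsum).trans_lt ?_).ne
    rw [ENNReal.tsum_geometric, ENNReal.one_sub_inv_two, inv_inv]
    exact ENNReal.ofNat_lt_top
  obtain ⟨Y, mY, f, hf, hqs, -, hfA⟩ := exists_isQuasisymmetric_of_tsum_ne_top
    (fun i : ℕ × ℕ => A i.1 i.2) (fun i => r i.1 i.2) (fun i => hr i.1 i.2)
    (fun i => hA i.1 i.2) s hsum p
  refine ⟨Y, mY, f, hf, hqs, ?_⟩
  let : MeasurableSpace Y := borel Y
  have : BorelSpace Y := ⟨rfl⟩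
  set q : ℝ := 1 + p * (1 - s) with hq
  have hq1 : 1 ≤ q := by
    have : 0 ≤ (p : ℝ) * (1 - s) := mul_nonneg p.cast_nonneg (by linarith)
    linarith
  have hrs : ∀ n k, ENNReal.ofReal (r n k ^ (s : ℝ)) ≤ 2⁻¹ ^ n := fun n k =>
    (ENNReal.le_tsum k).trans (hAsum n)
  have hr1 : ∀ n k, r n k ≤ 1 := by
    intro n k
    have h1 : ENNReal.ofReal (r n k ^ (s : ℝ)) ≤ 1 :=
      (hrs n k).trans (pow_le_one₀ zero_le (by simp))
    rw [ENNReal.ofReal_le_one] at h1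
    exact (Real.rpow_le_one_iff_of_pos (hr n k)).1 h1 |>.resolve_left (fun h => by linarith [h.2])
      |>.1
  have hdiam : ∀ n k, ediam (f '' A n k) ≤ ENNReal.ofReal (2 ^ p * r n k ^ q) := by
    intro n k
    refine ediam_le ?_
    rintro _ ⟨x, hx, rfl⟩ _ ⟨y, hy, rfl⟩
    rw [edist_dist]
    exact ENNReal.ofReal_le_ofReal (hfA (n, k) x hx y hy)
  have hmeas : μH[(ε.toNNReal : ℝ)] (univ : Set Y) ≠ ∞ := by
    have hconst : ∀ n, ∑' k, ediam (f '' A n k) ^ (ε.toNNReal : ℝ) ≤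
        ENNReal.ofReal ((2 ^ p) ^ ε) := by
      intro n
      rw [Real.coe_toNNReal _ hε.le]
      calc ∑' k, ediam (f '' A n k) ^ ε
          ≤ ∑' k, ENNReal.ofReal ((2 ^ p) ^ ε) * ENNReal.ofReal (r n k ^ (s : ℝ)) := by
            refine ENNReal.tsum_le_tsum fun k => ?_
            refine (ENNReal.rpow_le_rpow (hdiam n k) hε.le).trans ?_
            have hrq := Real.rpow_nonneg (hr n k).le q
            rw [ENNReal.ofReal_rpow_of_nonneg (by positivity) hε.le,
              ← ENNReal.ofReal_mul (by positivity), Real.mul_rpow (by positivity) hrq,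
              ← Real.rpow_mul (hr n k).le]
            refine ENNReal.ofReal_le_ofReal ?_
            gcongr ?_ * ?_
            exact Real.rpow_le_rpow_of_exponent_ge (hr n k) (hr1 n k) (by linarith)
        _ ≤ ENNReal.ofReal ((2 ^ p) ^ ε) * 1 := by
            rw [ENNReal.tsum_mul_left]
            gcongr
            exact (hAsum n).trans (pow_le_one₀ zero_le (by simp))
        _ = _ := mul_one _
    have hle := Measure.hausdorffMeasure_le_liminf_tsum (ε.toNNReal : ℝ) (univ : Set Y)
      (l := atTop) (fun n : ℕ => ENNReal.ofReal (2 ^ p) * 2⁻¹ ^ n) ?_ (fun n k => f '' A n k) ?_ ?_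
    · refine (hle.trans_lt (lt_of_le_of_lt ?_
        (ENNReal.ofReal_lt_top (r := (2 ^ p) ^ ε)))).ne
      exact (liminf_le_liminf (Eventually.of_forall hconst)).trans (liminf_const _).le
    · have h := ENNReal.Tendsto.const_mul (a := ENNReal.ofReal (2 ^ p))
        (ENNReal.tendsto_pow_atTop_nhds_zero_of_lt_one (r := 2⁻¹) (by simp))
        (Or.inr ENNReal.ofReal_ne_top)
      rwa [mul_zero] at h
    · refine Eventually.of_forall fun n k => (hdiam n k).trans ?_
      rw [ENNReal.ofReal_mul (by positivity)]
      gcongr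
      exact (ENNReal.ofReal_le_ofReal
        (Real.rpow_le_rpow_of_exponent_ge (hr n k) (hr1 n k) (by linarith))).trans (hrs n k)
    · refine Eventually.of_forall fun n => ?_
      rw [← image_iUnion, univ_subset_iff.1 (hAc n), hf.1.image_eq]
  exact dimH_le_of_hausdorffMeasure_ne_top hmeas

lemma exists_cover_of_coverNumber_lt {X : Type*} [MetricSpace X] {F : Set X} {r b : ℝ}
    (h : coverNumber F r < ENNReal.ofReal b) :
    ∃ (k : ℕ) (A : Fin k → Set X), (k : ℝ) ≤ b ∧ (∀ i, diam (A i) ≤ r) ∧ F ⊆ ⋃ i, A i := by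
  obtain ⟨_, ⟨k, A, rfl, hA, hF⟩, hk⟩ := sInf_lt_iff.1 h
  exact ⟨k, A, (ENNReal.natCast_lt_ofReal.1 hk).le, hA, hF⟩

lemma upperBoxDim_le {X : Type*} [MetricSpace X] {s C : ℝ} (hs : 0 < s) (hC : 0 < C)
    (h : ∀ r, 0 < r → r < diam (univ : Set X) →
      ∃ (k : ℕ) (A : Fin k → Set X), (k : ℝ) ≤ C * r ^ (-s) ∧ (∀ i, diam (A i) ≤ r) ∧
        univ ⊆ ⋃ i, A i) : upperBoxDim X ≤ s := by
  refine csInf_le ⟨0, fun t ht => ht.1.le⟩ ⟨hs, C, hC, fun r hr hrX => ?_⟩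
  obtain ⟨k, A, hk, hA, hF⟩ := h r hr hrX
  have hle : coverNumber (univ : Set X) r ≤ (k : ℝ≥0∞) := sInf_le ⟨k, A, rfl, hA, hF⟩
  refine hle.trans ?_
  rw [← ENNReal.ofReal_natCast]
  exact ENNReal.ofReal_le_ofReal hk

lemma exists_isQuasisymmetric_of_covers {X : Type} [MetricSpace X]
    (htb : TotallyBounded (univ : Set X)) {s C D : ℝ} (hs0 : 0 < s) (hs1 : s < 1) (hC : 0 < C)
    (hD : 0 < D) [Nonempty X]
    (h : ∀ n : ℕ, ∃ (k : ℕ) (A : Fin k → Set X), (k : ℝ) ≤ C * (D * (1 / 2) ^ n) ^ (-s) ∧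
      (∀ i, diam (A i) ≤ D * (1 / 2) ^ n) ∧ univ ⊆ ⋃ i, A i)
    {ε : ℝ} (hε : 0 < ε) :
    ∃ (Y : Type) (_ : MetricSpace Y) (f : X → Y), TotallyBounded (univ : Set Y) ∧
      IsHomeoOn f univ univ ∧ IsQuasisymmetric f ∧ upperBoxDim Y ≤ ε := by
  choose N A hN hA hcov using h
  set r : ℕ → ℝ := fun n => D * (1 / 2) ^ n with hr
  have hr0 : ∀ n, 0 < r n := fun n => by positivity
  set s₁ : ℝ := (s + 1) / 2 with hs₁
  have hs₁1 : s₁ < 1 := by linarith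
  have hss₁ : 0 < s₁ - s := by linarith
  obtain ⟨p, hp⟩ := exists_nat_le_mul_one_add_mul (t := s) hs₁1 hε
  have : Nonempty (Σ n, Fin (N n)) := by
    obtain ⟨x⟩ := ‹Nonempty X›
    obtain ⟨i, -⟩ := mem_iUnion.1 (hcov 0 (mem_univ x))
    exact ⟨⟨0, i⟩⟩
  have hsum : ∑' i : Σ n, Fin (N n), ENNReal.ofReal (r i.1 ^ s₁) ≠ ∞ := by
    have hterm : ∀ n, (N n : ℝ) * r n ^ s₁ ≤
        C * D ^ (s₁ - s) * ((1 / 2 : ℝ) ^ (s₁ - s)) ^ n := by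
      intro n
      calc (N n : ℝ) * r n ^ s₁ ≤ C * r n ^ (-s) * r n ^ s₁ :=
            mul_le_mul_of_nonneg_right (hN n) (by have := hr0 n; positivity)
        _ = C * r n ^ (s₁ - s) := by
            rw [mul_assoc, ← Real.rpow_add (hr0 n)]; congr 2; ring
        _ = _ := by
            rw [hr, Real.mul_rpow hD.le (by positivity), ← Real.rpow_natCast_mul (by norm_num),
              mul_comm (n : ℝ), Real.rpow_mul_natCast (by norm_num), mul_assoc]
    have hgeom : Summable fun n : ℕ =>
        C * D ^ (s₁ - s) * ((1 / 2 : ℝ) ^ (s₁ - s)) ^ n :=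
      (summable_geometric_of_lt_one (by positivity)
        (Real.rpow_lt_one (by norm_num) (by norm_num) hss₁)).mul_left _
    rw [ENNReal.tsum_sigma']
    refine ne_top_of_le_ne_top hgeom.tsum_ofReal_ne_top (ENNReal.tsum_le_tsum fun n => ?_)
    rw [tsum_fintype]
    change ∑ _i : Fin (N n), ENNReal.ofReal (r n ^ s₁) ≤ _
    rw [Finset.sum_const, Finset.card_univ, Fintype.card_fin, nsmul_eq_mul,
      ← ENNReal.ofReal_natCast, ← ENNReal.ofReal_mul (Nat.cast_nonneg _)]
    exact ENNReal.ofReal_le_ofReal (hterm n)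
  obtain ⟨Y, mY, f, hf, hqs, htbY, hfA⟩ := exists_isQuasisymmetric_of_tsum_ne_top
    (fun i : Σ n, Fin (N n) => A i.1 i.2) (fun i => r i.1) (fun i => hr0 i.1)
    (fun i x hx y hy => (dist_le_diam_of_mem (htb.isBounded.subset (subset_univ _)) hx hy).trans
      (hA i.1 i.2)) s₁ hsum p
  refine ⟨Y, mY, f, htbY htb, hf, hqs, ?_⟩
  set q : ℝ := 1 + p * (1 - s₁) with hq
  have hq0 : 0 < q := by
    have : 0 ≤ (p : ℝ) * (1 - s₁) := mul_nonneg p.cast_nonneg (by linarith)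
    linarith
  set K : ℝ := max (2 ^ p) (diam (univ : Set Y) / D ^ q) with hK
  have hK0 : 0 < K := lt_max_of_lt_left (by positivity)
  have hrq : ∀ n, r n ^ q = D ^ q * ((1 / 2 : ℝ) ^ q) ^ n := fun n => by
    rw [hr, Real.mul_rpow hD.le (by positivity), ← Real.rpow_natCast_mul (by norm_num),
      mul_comm (n : ℝ), Real.rpow_mul_natCast (by norm_num)]
  have hDq : 0 < D ^ q := by positivity
  have hhalf : (1 / 2 : ℝ) ^ q * 2 ^ q = 1 := by
    rw [← Real.mul_rpow (by norm_num) (by norm_num)]; norm_num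
  refine (upperBoxDim_le (s := s / q) (C := C * (K * 2 ^ q) ^ (s / q)) (by positivity)
    (by positivity) fun ρ hρ hρY => ?_).trans ((div_le_iff₀ hq0).2 hp)
  have hKD : 0 < K * D ^ q := by positivity
  obtain ⟨n, hn, hn'⟩ := exists_nat_pow_near_of_lt_one (x := ρ / (K * D ^ q))
    (y := (1 / 2 : ℝ) ^ q) (by positivity) (by
      rw [div_le_one hKD]
      refine hρY.le.trans ?_
      rw [← div_le_iff₀ hDq]
      exact le_max_right _ _) (by positivity) (Real.rpow_lt_one (by norm_num) (by norm_num) hq0)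
  rw [lt_div_iff₀ hKD] at hn
  rw [div_le_iff₀ hKD] at hn'
  have hlow : K * r (n + 1) ^ q ≤ ρ := by
    rw [hrq]; linarith
  have hup : ρ ≤ K * 2 ^ q * r (n + 1) ^ q := by
    rw [hrq, pow_succ]
    calc ρ ≤ _ := hn'
      _ = ((1 / 2 : ℝ) ^ q) ^ n * (K * D ^ q) * ((1 / 2 : ℝ) ^ q * 2 ^ q) := by
        rw [hhalf, mul_one]
      _ = _ := by ring
  refine ⟨N (n + 1), fun i => f '' A (n + 1) i, (hN (n + 1)).trans ?_, fun i => ?_, ?_⟩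
  · rw [mul_assoc]
    refine mul_le_mul_of_nonneg_left ?_ hC.le
    have hrn := hr0 (n + 1)
    have h1 : ρ ^ (s / q) ≤ (K * 2 ^ q) ^ (s / q) * r (n + 1) ^ s := by
      refine (Real.rpow_le_rpow hρ.le hup (by positivity)).trans_eq ?_
      rw [Real.mul_rpow (by positivity) (by positivity), ← Real.rpow_mul hrn.le,
        mul_div_cancel₀ _ hq0.ne']
    rw [Real.rpow_neg hρ.le, ← div_eq_mul_inv, le_div_iff₀ (by positivity)]
    change r (n + 1) ^ (-s) * _ ≤ _
    rw [Real.rpow_neg hrn.le, inv_mul_le_iff₀ (by positivity), mul_comm]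
    exact h1
  · refine diam_le_of_forall_dist_le hρ.le ?_
    rintro _ ⟨x, hx, rfl⟩ _ ⟨y, hy, rfl⟩
    refine (hfA ⟨n + 1, i⟩ x hx y hy).trans (le_trans ?_ hlow)
    exact mul_le_mul_of_nonneg_right (le_max_left _ _) (Real.rpow_nonneg (hr0 _).le _)
  · rw [← image_iUnion, univ_subset_iff.1 (hcov (n + 1)), hf.1.image_eq]

lemma exists_isQuasisymmetric_upperBoxDim_le {X : Type} [MetricSpace X]
    (htb : TotallyBounded (univ : Set X)) (hX : upperBoxDim X < 1) {ε : ℝ} (hε : 0 < ε) :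
    ∃ (Y : Type) (_ : MetricSpace Y) (f : X → Y), TotallyBounded (univ : Set Y) ∧
      IsHomeoOn f univ univ ∧ IsQuasisymmetric f ∧ upperBoxDim Y ≤ ε := by
  by_cases hdim : upperBoxDim X ≤ ε
  · exact ⟨X, _, id, htb, isHomeoOn_univ (Equiv.refl X) continuous_id continuous_id,
      isQuasisymmetric_id, hdim⟩
  have hD : 0 < diam (univ : Set X) := by
    refine diam_nonneg.lt_of_ne fun h => hdim (upperBoxDim_le hε one_pos fun r hr hrX => ?_)
    linarith
  have hne : Nonempty X := by
    by_contra hX'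
    rw [not_nonempty_iff] at hX'
    simp [univ_eq_empty_iff.2 hX'] at hD
  have hnonempty : { s : ℝ | 0 < s ∧ ∃ C : ℝ, 0 < C ∧ ∀ r : ℝ, 0 < r →
      r < diam (univ : Set X) →
      coverNumber (univ : Set X) r ≤ ENNReal.ofReal (C * r ^ (-s)) }.Nonempty := by
    by_contra hempty
    rw [not_nonempty_iff_eq_empty] at hempty
    rw [upperBoxDim, hempty, Real.sInf_empty] at hdim
    exact hdim hε.le
  obtain ⟨s, ⟨hs0, C, hC, hcov⟩, hs1⟩ := exists_lt_of_csInf_lt hnonempty hX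
  have hD2 : 0 < diam (univ : Set X) / 2 := by positivity
  refine exists_isQuasisymmetric_of_covers htb hs0 hs1 (mul_pos two_pos hC) hD2 (fun n => ?_) hε
  have hr : 0 < diam (univ : Set X) / 2 * (1 / 2) ^ n := by positivity
  have hrD : diam (univ : Set X) / 2 * (1 / 2) ^ n < diam (univ : Set X) := by
    have : (1 / 2 : ℝ) ^ n ≤ 1 := pow_le_one₀ (by norm_num) (by norm_num)
    nlinarith
  refine exists_cover_of_coverNumber_lt ((hcov _ hr hrD).trans_lt ?_)
  have : 0 < C * (diam (univ : Set X) / 2 * (1 / 2) ^ n) ^ (-s) := by positivity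
  rw [ENNReal.ofReal_lt_ofReal_iff (by linarith)]
  linarith

/-- Kovalev's theorem: a metric space of Hausdorff (resp. upper box-counting)
dimension strictly less than `1` can be mapped by a quasisymmetric homeomorphism
onto a space of arbitrarily small Hausdorff (resp. upper box-counting) dimension. -/
theorem kovalev_dim_reduction :
    (∀ (X : Type) (_ : MetricSpace X), dimH (Set.univ : Set X) < 1 →
      ∀ ε : ℝ, 0 < ε →
        ∃ (Y : Type) (_ : MetricSpace Y) (f : X → Y),
          IsHomeoOn f Set.univ Set.univ ∧ IsQuasisymmetric f ∧
          dimH (Set.univ : Set Y) ≤ ENNReal.ofReal ε) ∧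
    (∀ (X : Type) (_ : MetricSpace X), TotallyBounded (Set.univ : Set X) →
      upperBoxDim X < 1 →
      ∀ ε : ℝ, 0 < ε →
        ∃ (Y : Type) (_ : MetricSpace Y) (f : X → Y),
          TotallyBounded (Set.univ : Set Y) ∧
          IsHomeoOn f Set.univ Set.univ ∧ IsQuasisymmetric f ∧
          upperBoxDim Y ≤ ε) := by
  exact ⟨fun X _ h ε hε => exists_isQuasisymmetric_dimH_le h hε,
    fun X _ htb h ε hε => exists_isQuasisymmetric_upperBoxDim_le htb h hε⟩
end
end

section
/- Let Ω ⊆ ℝ^n be a domain with n ≥ 2, let p > n, let f ∈ W^{1,p}(Ω : ℝ^N) be continuous, and let E be a compact subset of Ω. Then for every θ ∈ (0,1), dim_θ f(E) ≤ p·dim_θ E/(p − n + dim_θ E). -/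
open Set Filter MeasureTheory Metric Topology
open scoped ENNReal NNReal

noncomputable section

/-- A continuous map `f` belongs to `W^{1,p}(Ω : ℝ^N)`: there is a locally integrable
weak derivative `Df : Ω → (ℝ^n →L ℝ^N)` with `∫_Ω ‖Df‖^p < ∞`. -/
def MemW1p (n N : ℕ) (p : ℝ) (Ω : Set (EuclideanSpace ℝ (Fin n)))
    (f : EuclideanSpace ℝ (Fin n) → EuclideanSpace ℝ (Fin N)) : Prop :=
  ∃ Df : EuclideanSpace ℝ (Fin n) → (EuclideanSpace ℝ (Fin n) →L[ℝ] EuclideanSpace ℝ (Fin N)),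
    LocallyIntegrableOn Df Ω volume ∧
    (∫⁻ x in Ω, ENNReal.ofReal (‖Df x‖ ^ p) ∂volume) < ⊤ ∧
    ∀ φ : EuclideanSpace ℝ (Fin n) → ℝ, ContDiff ℝ (⊤ : ℕ∞) φ → HasCompactSupport φ →
      tsupport φ ⊆ Ω → ∀ v : EuclideanSpace ℝ (Fin n),
        (∫ x in Ω, (fderiv ℝ φ x v) • f x ∂volume) = - ∫ x in Ω, (φ x) • (Df x v) ∂volume

/-- `f ∈ W^{1,p}_loc(Ω : ℝ^N)`: the restriction of `f` to every open set compactly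
contained in `Ω` belongs to `W^{1,p}`. -/
def MemW1pLoc (n N : ℕ) (p : ℝ) (Ω : Set (EuclideanSpace ℝ (Fin n)))
    (f : EuclideanSpace ℝ (Fin n) → EuclideanSpace ℝ (Fin N)) : Prop :=
  ∀ U : Set (EuclideanSpace ℝ (Fin n)), IsOpen U → IsCompact (closure U) →
    closure U ⊆ Ω → MemW1p n N p U f

open Module

/-- Differentiation under the integral sign over a compact set, for a jointly continuous
derivative of the scalar kernel. -/
theorem hasDerivAt_setIntegral_smul_of_isCompact {V W : Type*} [NormedAddCommGroup V]
    [MeasurableSpace V] [BorelSpace V] [NormedAddCommGroup W]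
    [NormedSpace ℝ W] {μ : Measure V} [IsFiniteMeasureOnCompacts μ]
    {L : Set V} (hL : IsCompact L) {f : V → W} (hf : ContinuousOn f L) {U : Set ℝ} (hU : IsOpen U)
    {g g' : ℝ → V → ℝ} (hg : ∀ t ∈ U, Continuous (g t))
    (hg' : ContinuousOn (fun q : ℝ × V => g' q.1 q.2) (U ×ˢ univ))
    (hd : ∀ t ∈ U, ∀ z, HasDerivAt (fun t => g t z) (g' t z) t) {t : ℝ} (ht : t ∈ U) :
    HasDerivAt (fun t => ∫ z in L, g t z • f z ∂μ) (∫ z in L, g' t z • f z ∂μ) t := by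
  obtain ⟨ε, hε, hεU⟩ := Metric.nhds_basis_closedBall.mem_iff.1 (hU.mem_nhds ht)
  have hsub : closedBall t ε ×ˢ L ⊆ U ×ˢ univ := prod_mono hεU (subset_univ _)
  obtain ⟨C, hC⟩ := ((isCompact_closedBall t ε).prod hL).exists_bound_of_continuousOn
    (f := fun q : ℝ × V => g' q.1 q.2 • f q.2)
    ((hg'.mono hsub).smul (hf.comp continuousOn_snd fun q hq => hq.2))
  have hcont : ∀ s ∈ U, ContinuousOn (fun z => g' s z) L := fun s hs =>
    hg'.comp (f := fun z => (s, z)) (by fun_prop) fun z _ => ⟨hs, mem_univ _⟩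
  refine (hasDerivAt_integral_of_dominated_loc_of_deriv_le (μ := μ.restrict L)
    (F := fun t z => g t z • f z) (F' := fun t z => g' t z • f z) (bound := fun _ => C)
    (closedBall_mem_nhds t hε) ?_ ?_ ?_ ?_ ?_ ?_).2
  · filter_upwards [hU.mem_nhds ht] with s hs
    exact (((hg s hs).continuousOn.smul hf).integrableOn_compact hL).aestronglyMeasurable
  · exact ((hg t ht).continuousOn.smul hf).integrableOn_compact hL
  · exact (((hcont t ht).smul hf).integrableOn_compact hL).aestronglyMeasurable
  · filter_upwards [ae_restrict_mem hL.measurableSet] with z hz s hs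
    exact hC (s, z) ⟨hs, hz⟩
  · exact integrableOn_const hL.measure_lt_top.ne
  · exact .of_forall fun z s hs => (hd s (hεU hs) z).smul_const (f z)

/-- `φ` rescaled by the factor `t` about the point `x`. -/
def rescale {V : Type*} [AddCommGroup V] [Module ℝ V] (φ : V → ℝ) (x : V) (t : ℝ) : V → ℝ :=
  fun z => φ (x + t⁻¹ • (z - x))

section Rescale

variable {V W : Type*} [NormedAddCommGroup V] [NormedSpace ℝ V] 
  [NormedAddCommGroup W] [NormedSpace ℝ W] {φ : V → ℝ}

theorem ContDiff.rescale {m : WithTop ℕ∞} (hφ : ContDiff ℝ m φ) (x : V) (t : ℝ) :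
    ContDiff ℝ m (rescale φ x t) := by
  unfold _root_.rescale
  fun_prop

theorem fderiv_rescale (hφ : Differentiable ℝ φ) (x : V) (t : ℝ) (z v : V) :
    fderiv ℝ (rescale φ x t) z v = fderiv ℝ φ (x + t⁻¹ • (z - x)) (t⁻¹ • v) := by
  have h2 : HasFDerivAt (fun z : V => x + t⁻¹ • (z - x)) (t⁻¹ • ContinuousLinearMap.id ℝ V) z := by
    simpa using (((hasFDerivAt_id z).sub_const x).const_smul t⁻¹).const_add x
  have := (hφ (x + t⁻¹ • (z - x))).hasFDerivAt.comp z h2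
  rw [show rescale φ x t = φ ∘ fun z : V => x + t⁻¹ • (z - x) from rfl, this.fderiv]
  simp

theorem tsupport_rescale_subset {x c : V} {ρ t : ℝ} (ht : 0 < t)
    (hφ : tsupport φ ⊆ closedBall c ρ) :
    tsupport (rescale φ x t) ⊆ closedBall (x + t • (c - x)) (t * ρ) := by
  refine closure_minimal (fun z hz => ?_) isClosed_closedBall
  have h1 := hφ (subset_tsupport φ (show x + t⁻¹ • (z - x) ∈ Function.support φ from hz))
  rw [mem_closedBall, dist_eq_norm] at h1 ⊢
  have h2 : z - (x + t • (c - x)) = t • (x + t⁻¹ • (z - x) - c) := by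
    rw [smul_sub t (x + _) c, smul_add, smul_inv_smul₀ ht.ne']; module
  rw [h2, norm_smul, Real.norm_of_nonneg ht.le]
  gcongr

theorem hasDerivAt_pow_mul_rescale (hφ : Differentiable ℝ φ) (n : ℕ) (x z : V) {t : ℝ}
    (ht : 0 < t) :
    HasDerivAt (fun t => (t ^ n)⁻¹ * rescale φ x t z)
      (-((t ^ (n + 1))⁻¹ * (n * rescale φ x t z + fderiv ℝ (rescale φ x t) z (z - x)))) t := by
  have h1 : HasDerivAt (fun t : ℝ => x + t⁻¹ • (z - x)) ((-(t ^ 2)⁻¹) • (z - x)) t :=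
    ((hasDerivAt_inv ht.ne').smul_const _).const_add x
  have h2 := (hφ (x + t⁻¹ • (z - x))).hasFDerivAt.comp_hasDerivAt t h1
  have h3 := (hasDerivAt_pow n t).inv (by positivity)
  refine (h3.mul h2).congr_deriv ?_
  rw [fderiv_rescale hφ]
  simp only [rescale, Function.comp, map_smul, smul_eq_mul]
  rcases n with _ | n
  · simp; field_simp
  · simp; field_simp; ring

theorem continuousOn_deriv_rescale (hφ : ContDiff ℝ 1 φ) (n : ℕ) (x : V) :
    ContinuousOn (fun q : ℝ × V => -((q.1 ^ (n + 1))⁻¹ * (n * rescale φ x q.1 q.2 +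
      fderiv ℝ (rescale φ x q.1) q.2 (q.2 - x)))) (Ioi 0 ×ˢ univ) := by
  have hd := hφ.differentiable one_ne_zero
  simp only [fderiv_rescale hd, rescale]
  have h1 : ContinuousOn (fun q : ℝ × V => q.1⁻¹) (Ioi 0 ×ˢ univ) :=
    continuousOn_fst.inv₀ fun q hq => (ne_of_gt hq.1)
  have h2 : ContinuousOn (fun q : ℝ × V => (q.1 ^ (n + 1))⁻¹) (Ioi 0 ×ˢ univ) :=
    (continuousOn_fst.pow _).inv₀ fun q hq => pow_ne_zero _ (ne_of_gt hq.1)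
  have h3 : ContinuousOn (fun q : ℝ × V => x + q.1⁻¹ • (q.2 - x)) (Ioi 0 ×ˢ univ) := by
    fun_prop
  have h4 := hφ.continuous.comp_continuousOn h3
  have h5 := (hφ.continuous_fderiv one_ne_zero).comp_continuousOn h3
  exact (h2.mul ((continuousOn_const.mul h4).add (h5.clm_apply (by fun_prop)))).neg

end Rescale

section WeakDerivative

variable {n N : ℕ} {Ω : Set (EuclideanSpace ℝ (Fin n))}
  {f : EuclideanSpace ℝ (Fin n) → EuclideanSpace ℝ (Fin N)}
  {Df : EuclideanSpace ℝ (Fin n) → (EuclideanSpace ℝ (Fin n) →L[ℝ] EuclideanSpace ℝ (Fin N))}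

/-- `Df` is a weak derivative of `f` on `Ω`. -/
def IsWeakDeriv (Ω : Set (EuclideanSpace ℝ (Fin n)))
    (f : EuclideanSpace ℝ (Fin n) → EuclideanSpace ℝ (Fin N))
    (Df : EuclideanSpace ℝ (Fin n) →
      (EuclideanSpace ℝ (Fin n) →L[ℝ] EuclideanSpace ℝ (Fin N))) : Prop :=
  ∀ φ : EuclideanSpace ℝ (Fin n) → ℝ, ContDiff ℝ (⊤ : ℕ∞) φ → HasCompactSupport φ →
    tsupport φ ⊆ Ω → ∀ v : EuclideanSpace ℝ (Fin n),
      (∫ x in Ω, (fderiv ℝ φ x v) • f x ∂volume) = - ∫ x in Ω, (φ x) • (Df x v) ∂volume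

theorem integrableOn_smul_of_tsupport_subset {V W : Type*} [NormedAddCommGroup V]
    [MeasurableSpace V] [BorelSpace V] [NormedAddCommGroup W] [NormedSpace ℝ W] {μ : Measure V}
    {Ω : Set V} {ψ : V → ℝ} {h : V → W} (hψ : Continuous ψ) (hc : HasCompactSupport ψ)
    (hs : tsupport ψ ⊆ Ω) (hh : LocallyIntegrableOn h Ω μ) :
    IntegrableOn (fun z => ψ z • h z) Ω μ := by
  have h1 : IntegrableOn (fun z => ψ z • h z) (tsupport ψ) μ :=
    (hh.integrableOn_compact_subset hs hc).continuousOn_smul hψ.continuousOn hc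
  have h2 : Integrable (fun z => ψ z • h z) μ :=
    (integrableOn_iff_integrable_of_support_subset
      ((Function.support_smul_subset_left ψ h).trans (subset_tsupport ψ))).1 h1
  exact h2.integrableOn

/-- Testing a weak derivative against the vector field `ψ(z)(z - x)`. -/
theorem IsWeakDeriv.integral_radial (hw : IsWeakDeriv Ω f Df) (hΩ : IsOpen Ω)
    (hf : ContinuousOn f Ω)
    (hD : LocallyIntegrableOn Df Ω volume) {ψ : EuclideanSpace ℝ (Fin n) → ℝ}
    (hψ : ContDiff ℝ (⊤ : ℕ∞) ψ) (hc : HasCompactSupport ψ) (hs : tsupport ψ ⊆ Ω)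
    (x : EuclideanSpace ℝ (Fin n)) :
    ∫ z in Ω, (n * ψ z + fderiv ℝ ψ z (z - x)) • f z = - ∫ z in Ω, ψ z • Df z (z - x) := by
  have hcoord (i : Fin n) : ContDiff ℝ (⊤ : ℕ∞)
      (fun z : EuclideanSpace ℝ (Fin n) => z i - x i) := by fun_prop
  have hfd (i : Fin n) (z : EuclideanSpace ℝ (Fin n)) :
      fderiv ℝ (fun z : EuclideanSpace ℝ (Fin n) => (z i - x i) * ψ z) z
        (EuclideanSpace.single i 1) =
      ψ z + (z i - x i) * fderiv ℝ ψ z (EuclideanSpace.single i 1) := by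
    have h1 : HasFDerivAt (fun z : EuclideanSpace ℝ (Fin n) => z i - x i)
        (EuclideanSpace.proj i : EuclideanSpace ℝ (Fin n) →L[ℝ] ℝ) z :=
      (EuclideanSpace.proj i : EuclideanSpace ℝ (Fin n) →L[ℝ] ℝ).hasFDerivAt.sub_const (x i)
    have h2 := (hψ.differentiable (by simp) z).hasFDerivAt
    rw [(h1.fun_mul h2).fderiv]
    simp
    ring
  have hts (i : Fin n) : tsupport (fun z : EuclideanSpace ℝ (Fin n) => (z i - x i) * ψ z)
      ⊆ tsupport ψ := tsupport_mul_subset_right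
  have hcs (i : Fin n) :
      HasCompactSupport (fun z : EuclideanSpace ℝ (Fin n) => (z i - x i) * ψ z) :=
    hc.mul_left
  have hsm (i : Fin n) :
      ContDiff ℝ (⊤ : ℕ∞) (fun z : EuclideanSpace ℝ (Fin n) => (z i - x i) * ψ z) :=
    (hcoord i).mul hψ
  have hdec (z : EuclideanSpace ℝ (Fin n)) :
      z - x = ∑ i, (z i - x i) • EuclideanSpace.single i (1 : ℝ) := by
    ext j
    simp [Finset.sum_apply, Pi.single_apply]
  have hL : ∀ z, (n * ψ z + fderiv ℝ ψ z (z - x)) • f z = ∑ i,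
      fderiv ℝ (fun z : EuclideanSpace ℝ (Fin n) => (z i - x i) * ψ z) z
        (EuclideanSpace.single i 1) • f z := by
    intro z
    rw [← Finset.sum_smul]
    congr 1
    simp only [hfd, Finset.sum_add_distrib]
    congr 1
    · simp
    · conv_lhs => rw [hdec z]
      simp
  have hR : ∀ z, ψ z • Df z (z - x) =
      ∑ i, ((z i - x i) * ψ z) • Df z (EuclideanSpace.single i 1) := by
    intro z
    conv_lhs => rw [hdec z]
    simp [Finset.smul_sum, smul_smul, mul_comm]
  simp only [hL, hR]
  rw [integral_finsetSum, integral_finsetSum, ← Finset.sum_neg_distrib]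
  · exact Finset.sum_congr rfl fun i _ => hw _ (hsm i) (hcs i) ((hts i).trans hs) _
  · intro i _
    refine integrableOn_smul_of_tsupport_subset (hsm i).continuous (hcs i) ((hts i).trans hs) ?_
    intro z hz
    obtain ⟨u, hu, hi⟩ := hD z hz
    exact ⟨u, hu, hi.apply_continuousLinearMap _⟩
  · intro i _
    refine integrableOn_smul_of_tsupport_subset
      (((hsm i).continuous_fderiv (by simp)).clm_apply continuous_const)
      ((hcs i).fderiv_apply ℝ _) ?_
      (hf.locallyIntegrableOn hΩ.measurableSet)
    exact ((tsupport_fderiv_apply_subset ℝ _).trans (hts i)).trans hs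

/-- An elementary Hölder inequality on a set of finite measure. -/
theorem setIntegral_norm_le_rpow {α F : Type*} [MeasurableSpace α] {μ : Measure α}
    [NormedAddCommGroup F] {h : α → F} {s : Set α} {p : ℝ} (hp : 1 < p) (hs : μ s ≠ ⊤)
    (hm : AEStronglyMeasurable h (μ.restrict s))
    (hh : ∫⁻ z in s, ENNReal.ofReal (‖h z‖ ^ p) ∂μ ≠ ⊤) :
    ∫ z in s, ‖h z‖ ∂μ ≤ μ.real s ^ (1 - 1 / p) *
      (∫⁻ z in s, ENNReal.ofReal (‖h z‖ ^ p) ∂μ).toReal ^ (1 / p) := by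
  have hp0 : 0 < p := by linarith
  have hq : p.HolderConjugate (p.conjExponent) := .conjExponent hp
  have key := ENNReal.lintegral_mul_le_Lp_mul_Lq (μ.restrict s) hq
    (f := fun z => ‖h z‖ₑ) (g := fun _ => 1) hm.enorm aemeasurable_const
  have hq1 : 1 / p.conjExponent = 1 - 1 / p := by
    have := hq.inv_add_inv_eq_one
    simp only [one_div]; linarith
  have he : ∀ z, ENNReal.ofReal (‖h z‖ ^ p) = ‖h z‖ₑ ^ p := fun z => by
    rw [← ENNReal.ofReal_rpow_of_nonneg (norm_nonneg _) hp0.le, ofReal_norm]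
  simp only [he] at hh ⊢
  simp only [Pi.mul_apply, mul_one, ENNReal.one_rpow, lintegral_const, one_mul,
    Measure.restrict_apply_univ, hq1] at key
  rw [integral_norm_eq_lintegral_enorm hm]
  refine (ENNReal.toReal_mono ?_ key).trans_eq ?_
  · have : 0 ≤ 1 - 1 / p := by rw [← hq1]; exact one_div_nonneg.2 hq.symm.nonneg
    exact ENNReal.mul_ne_top (ENNReal.rpow_ne_top_of_nonneg (by positivity) hh)
      (ENNReal.rpow_ne_top_of_nonneg this hs)
  · rw [ENNReal.toReal_mul, ← ENNReal.toReal_rpow, ← ENNReal.toReal_rpow, mul_comm]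
    rfl

end WeakDerivative

section Morrey

variable {n N : ℕ} {Ω : Set (EuclideanSpace ℝ (Fin n))}
  {f : EuclideanSpace ℝ (Fin n) → EuclideanSpace ℝ (Fin N)}
  {Df : EuclideanSpace ℝ (Fin n) → (EuclideanSpace ℝ (Fin n) →L[ℝ] EuclideanSpace ℝ (Fin N))}

theorem integral_pow_inv_mul_rescale (φ : EuclideanSpace ℝ (Fin n) → ℝ)
    (x : EuclideanSpace ℝ (Fin n)) {t : ℝ} (ht : 0 < t) :
    ∫ z, (t ^ n)⁻¹ * rescale φ x t z = ∫ z, φ z := by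
  unfold rescale
  rw [integral_const_mul, integral_sub_right_eq_self (fun w => φ (x + t⁻¹ • w)) x,
    Measure.integral_comp_smul volume (fun u => φ (x + u)) t⁻¹,
    integral_add_left_eq_self φ x]
  have : 0 < t ^ n := by positivity
  simp [abs_of_pos this, this.ne']

/-- The constant in Morrey's inequality for a convex set containing a ball of radius `ρ`, of
diameter controlled by `D`, and with `I` the integral of the `p`-th power of the derivative. -/
def morreyConst (n : ℕ) (p ρ D I : ℝ) : ℝ :=
  (volume.real (closedBall (0 : EuclideanSpace ℝ (Fin n)) (ρ / 2)))⁻¹ * D *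
    (volume.real (closedBall (0 : EuclideanSpace ℝ (Fin n)) ρ) ^ (1 - 1 / p) * I ^ (1 / p))

/-- **Morrey's inequality** on a convex set containing a ball. -/
theorem IsWeakDeriv.exists_norm_sub_le (hw : IsWeakDeriv Ω f Df) (hΩ : IsOpen Ω)
    (hf : ContinuousOn f Ω) (hD : LocallyIntegrableOn Df Ω volume) (hn : 0 < n) {p : ℝ}
    (hp : n < p)
    {K : Set (EuclideanSpace ℝ (Fin n))} (hK : Convex ℝ K) (hKΩ : K ⊆ Ω)
    {c : EuclideanSpace ℝ (Fin n)} {ρ D : ℝ} (hρ : 0 < ρ) (hcK : closedBall c ρ ⊆ K)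
    (hdiam : ∀ x ∈ K, ∀ y ∈ closedBall c ρ, ‖y - x‖ ≤ D)
    (hfin : ∫⁻ z in K, ENNReal.ofReal (‖Df z‖ ^ p) ≠ ⊤) :
    ∃ a, ∀ x ∈ K, ‖f x - a‖ ≤ morreyConst n p ρ D
      (∫⁻ z in K, ENNReal.ofReal (‖Df z‖ ^ p)).toReal / (1 - n / p) := by
  have : Nonempty (Fin n) := ⟨⟨0, hn⟩⟩
  have hn1 : (1 : ℝ) ≤ n := by exact_mod_cast hn
  have hp1 : 1 < p := by linarith
  have hp0 : 0 < p := by linarith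
  have hD0 : 0 ≤ D := (norm_nonneg _).trans
    (hdiam c (hcK (mem_closedBall_self hρ.le)) c (mem_closedBall_self hρ.le))
  set I := (∫⁻ z in K, ENNReal.ofReal (‖Df z‖ ^ p)).toReal with hI
  set b : ContDiffBump c := ⟨ρ / 2, ρ, by positivity, by linarith⟩ with hb
  set φ : EuclideanSpace ℝ (Fin n) → ℝ := b.normed volume with hφdef
  have hφ : ContDiff ℝ (⊤ : ℕ∞) φ := b.contDiff_normed
  have hφ0 : ∀ z, 0 ≤ φ z := fun z => b.nonneg_normed z
  have hr0 : ∀ x t z, 0 ≤ rescale φ x t z := fun _ _ _ => hφ0 _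
  have hφM : ∀ z, φ z ≤ (volume.real (closedBall (0 : EuclideanSpace ℝ (Fin n)) (ρ / 2)))⁻¹ := by
    intro z
    have := b.normed_le_div_measure_closedBall_rIn volume z
    rwa [measureReal_def, Measure.addHaar_closedBall_center, ← measureReal_def, one_div] at this
  have hφs : tsupport φ ⊆ closedBall c ρ := (b.tsupport_normed_eq (μ := volume)).subset
  refine ⟨∫ z in Ω, φ z • f z, fun x hx => ?_⟩
  set L : Set (EuclideanSpace ℝ (Fin n)) :=
    (fun q : ℝ × EuclideanSpace ℝ (Fin n) => x + q.1 • (q.2 - x)) ''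
      (Icc 0 1 ×ˢ closedBall c ρ) with hLdef
  have hLc : IsCompact L := (isCompact_Icc.prod (isCompact_closedBall c ρ)).image (by fun_prop)
  have hLK : L ⊆ K := by
    rintro _ ⟨⟨t, y⟩, ⟨ht, hy⟩, rfl⟩
    exact hK.add_smul_sub_mem hx (hcK hy) ht
  have hball : ∀ t ∈ Ioc (0 : ℝ) 1, ∀ z ∈ closedBall (x + t • (c - x)) (t * ρ),
      z ∈ L ∧ ‖z - x‖ ≤ t * D := by
    intro t ht z hz
    have hy : x + t⁻¹ • (z - x) ∈ closedBall c ρ := by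
      rw [mem_closedBall, dist_eq_norm] at hz ⊢
      have h2 : x + t⁻¹ • (z - x) - c = t⁻¹ • (z - (x + t • (c - x))) := by
        rw [sub_add_eq_sub_sub, smul_sub t⁻¹ (z - x), inv_smul_smul₀ ht.1.ne']; abel
      rw [h2, norm_smul, norm_inv, Real.norm_of_nonneg ht.1.le, inv_mul_le_iff₀ ht.1]
      exact hz
    have hzy : z = x + t • (x + t⁻¹ • (z - x) - x) := by
      rw [add_sub_cancel_left, smul_inv_smul₀ ht.1.ne']; abel
    refine ⟨⟨(t, _), ⟨⟨ht.1.le, ht.2⟩, hy⟩, hzy.symm⟩, ?_⟩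
    have := hdiam x hx _ hy
    rw [add_sub_cancel_left, norm_smul, norm_inv, Real.norm_of_nonneg ht.1.le,
      inv_mul_le_iff₀ ht.1] at this
    exact this
  have hts : ∀ t ∈ Ioc (0 : ℝ) 1,
      tsupport (rescale φ x t) ⊆ closedBall (x + t • (c - x)) (t * ρ) := fun t ht =>
    tsupport_rescale_subset ht.1 hφs
  have hzero : ∀ t ∈ Ioc (0 : ℝ) 1, ∀ z, z ∉ closedBall (x + t • (c - x)) (t * ρ) →
      rescale φ x t z = 0 := fun t ht z hz => image_eq_zero_of_notMem_tsupport
        (fun h => hz (hts t ht h))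
  have hzeroL : ∀ t ∈ Ioc (0 : ℝ) 1, ∀ z, z ∉ L → rescale φ x t z = 0 := fun t ht z hz =>
    hzero t ht z fun h => hz (hball t ht z h).1
  set G : ℝ → EuclideanSpace ℝ (Fin N) :=
    fun t => ∫ z in L, ((t ^ n)⁻¹ * rescale φ x t z) • f z with hG
  set H : ℝ → EuclideanSpace ℝ (Fin N) := fun t => ∫ z in L,
    (-((t ^ (n + 1))⁻¹ * (n * rescale φ x t z + fderiv ℝ (rescale φ x t) z (z - x)))) • f z
    with hH
  have hderiv : ∀ t > 0, HasDerivAt G (H t) t := fun t ht =>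
    hasDerivAt_setIntegral_smul_of_isCompact hLc (hf.mono (hLK.trans hKΩ)) isOpen_Ioi
      (fun t _ => continuous_const.mul (hφ.rescale x t).continuous)
      (continuousOn_deriv_rescale (hφ.of_le (by simp)) n x)
      (fun t ht z => hasDerivAt_pow_mul_rescale (hφ.differentiable (by simp)) n x z ht) ht
  have hHbound : ∀ t ∈ Ioc (0 : ℝ) 1, ‖H t‖ ≤ morreyConst n p ρ D I * t ^ (-(n / p : ℝ)) := by
    intro t ht
    have ht0 := ht.1
    set B := closedBall (x + t • (c - x)) (t * ρ) with hBdef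
    have hBK : B ⊆ K := fun z hz => hLK (hball t ht z hz).1
    have hBc : IsCompact B := isCompact_closedBall _ _
    have hBΩ : B ⊆ Ω := hBK.trans hKΩ
    have hcs : HasCompactSupport (rescale φ x t) :=
      hBc.of_isClosed_subset (isClosed_tsupport _) (hts t ht)
    have hDB : IntegrableOn Df B := hD.integrableOn_compact_subset hBΩ hBc
    have hfL : ∀ z, z ∉ L →
        (n * rescale φ x t z + fderiv ℝ (rescale φ x t) z (z - x)) • f z = 0 := by
      intro z hz
      have hz' : z ∉ tsupport (rescale φ x t) := fun h => hz (hball t ht z (hts t ht h)).1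
      rw [hzeroL t ht z hz, image_eq_zero_of_notMem_tsupport
        (fun h => hz' (tsupport_fderiv_subset ℝ h))]
      simp
    have h1 : H t = (t ^ (n + 1))⁻¹ • ∫ z in B, rescale φ x t z • Df z (z - x) := by
      have e1 : H t = -((t ^ (n + 1))⁻¹ • ∫ z in L,
          (n * rescale φ x t z + fderiv ℝ (rescale φ x t) z (z - x)) • f z) := by
        rw [← integral_smul, ← integral_neg]
        simp only [hH, neg_smul, mul_smul]
      rw [e1, ← setIntegral_eq_of_subset_of_forall_sdiff_eq_zero hΩ.measurableSet
        (hLK.trans hKΩ) (fun z hz => hfL z hz.2),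
        hw.integral_radial hΩ hf hD (hφ.rescale x t) hcs ((hts t ht).trans hBΩ) x,
        smul_neg, neg_neg,
        ← setIntegral_eq_of_subset_of_forall_sdiff_eq_zero hΩ.measurableSet hBΩ]
      intro z hz
      rw [hzero t ht z hz.2, zero_smul]
    set M := (volume.real (closedBall (0 : EuclideanSpace ℝ (Fin n)) (ρ / 2)))⁻¹ with hM
    have hM0 : 0 ≤ M := by positivity
    have hmono : ∫⁻ z in B, ENNReal.ofReal (‖Df z‖ ^ p) ≤ ∫⁻ z in K, ENNReal.ofReal (‖Df z‖ ^ p) :=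
      lintegral_mono_set hBK
    have h2 : ‖∫ z in B, rescale φ x t z • Df z (z - x)‖ ≤ M * (t * D) * ∫ z in B, ‖Df z‖ := by
      rw [← integral_const_mul]
      refine norm_integral_le_of_norm_le (hDB.norm.const_mul _) ?_
      filter_upwards [ae_restrict_mem measurableSet_closedBall] with z hz
      rw [norm_smul, Real.norm_of_nonneg (hr0 _ _ _)]
      calc rescale φ x t z * ‖Df z (z - x)‖ ≤ M * (‖Df z‖ * (t * D)) := by
            refine mul_le_mul (hφM _) ?_ (norm_nonneg _) hM0
            exact (Df z).le_opNorm_of_le (hball t ht z hz).2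
        _ = M * (t * D) * ‖Df z‖ := by ring
    have h3 : ∫ z in B, ‖Df z‖ ≤ volume.real B ^ (1 - 1 / p) * I ^ (1 / p) := by
      refine (setIntegral_norm_le_rpow hp1 hBc.measure_lt_top.ne hDB.aestronglyMeasurable
        (ne_top_of_le_ne_top hfin hmono)).trans ?_
      gcongr
      exact ENNReal.toReal_mono hfin hmono
    have h4 : volume.real B =
        t ^ n * volume.real (closedBall (0 : EuclideanSpace ℝ (Fin n)) ρ) := by
      rw [hBdef, Measure.addHaar_real_closedBall _ _ (by positivity),
        Measure.addHaar_real_closedBall _ _ hρ.le, finrank_euclideanSpace, Fintype.card_fin,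
        mul_pow, mul_assoc]
    have h5 : (t ^ n : ℝ) ^ (1 - 1 / p) = t ^ n * t ^ (-(n / p : ℝ)) := by
      rw [← Real.rpow_natCast, ← Real.rpow_mul ht0.le, ← Real.rpow_add ht0]
      congr 1; ring
    rw [h4, Real.mul_rpow (by positivity) (by positivity), h5] at h3
    rw [h1, norm_smul, Real.norm_of_nonneg (by positivity)]
    calc _ ≤ (t ^ (n + 1))⁻¹ * (M * (t * D) * (t ^ n * t ^ (-(n / p : ℝ)) *
        volume.real (closedBall (0 : EuclideanSpace ℝ (Fin n)) ρ) ^ (1 - 1 / p) *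
          I ^ (1 / p))) := by
          gcongr
          exact h2.trans (by gcongr)
      _ = _ := by
        unfold morreyConst
        rw [← hM]
        field_simp
        ring
  have hlim : Tendsto G (𝓝[>] 0) (𝓝 (f x)) := by
    rw [Metric.tendsto_nhds]
    intro ε hε
    obtain ⟨δ, hδ, hfδ⟩ := Metric.continuousOn_iff.1 hf x (hKΩ hx) (ε / 2) (by positivity)
    filter_upwards [Ioo_mem_nhdsGT (show (0 : ℝ) < min 1 (δ / (D + 1)) by positivity)] with t ht
    have ht' : t ∈ Ioc (0 : ℝ) 1 := ⟨ht.1, ht.2.le.trans (min_le_left _ _)⟩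
    have htδ : t * D < δ := by
      have := (lt_div_iff₀ (by positivity)).1 (ht.2.trans_le (min_le_right _ _))
      nlinarith [ht.1]
    have hker : ContinuousOn (fun z => (t ^ n)⁻¹ * rescale φ x t z) L :=
      (continuous_const.mul (hφ.rescale x t).continuous).continuousOn
    have hone : ∫ z in L, (t ^ n)⁻¹ * rescale φ x t z = 1 := by
      rw [setIntegral_eq_integral_of_forall_compl_eq_zero, integral_pow_inv_mul_rescale φ x ht.1]
      · exact b.integral_normed
      · intro z hz
        rw [hzeroL t ht' z hz, mul_zero]
    have hfx : f x = ∫ z in L, ((t ^ n)⁻¹ * rescale φ x t z) • f x := by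
      rw [integral_smul_const, hone, one_smul]
    rw [dist_eq_norm, hfx, ← integral_sub]
    · refine (norm_integral_le_of_norm_le
        (g := fun z => ((t ^ n)⁻¹ * rescale φ x t z) * (ε / 2)) ?_ ?_).trans_lt ?_
      · exact (hker.integrableOn_compact hLc).mul_const _
      · refine .of_forall fun z => ?_
        rw [← smul_sub, norm_smul, Real.norm_of_nonneg (mul_nonneg (by have := ht.1; positivity)
          (hr0 _ _ _))]
        by_cases hz : z ∈ closedBall (x + t • (c - x)) (t * ρ)
        · obtain ⟨hzL, hzd⟩ := hball t ht' z hz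
          have := hfδ z (hKΩ (hLK hzL)) (by rw [dist_eq_norm]; exact hzd.trans_lt htδ)
          rw [dist_eq_norm] at this
          exact mul_le_mul_of_nonneg_left this.le
            (mul_nonneg (by have := ht.1; positivity) (hφ0 _))
        · rw [hzero t ht' z hz]; simp
      · rw [integral_mul_const, hone]; linarith
    · exact (hker.smul (hf.mono (hLK.trans hKΩ))).integrableOn_compact hLc
    · exact (hker.smul continuousOn_const).integrableOn_compact hLc
  have hG1 : G 1 = ∫ z in Ω, φ z • f z := by
    have h1 : rescale φ x 1 = φ := by ext z; simp [rescale]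
    rw [setIntegral_eq_of_subset_of_forall_sdiff_eq_zero hΩ.measurableSet (hLK.trans hKΩ)]
    · simp [hG, h1]
    · intro z hz
      rw [← h1, hzeroL 1 (by simp) z hz.2, zero_smul]
  have hnp : 0 < 1 - n / p := by rw [sub_pos, div_lt_one hp0]; exact hp
  have hinc : ∀ a ∈ Ioo (0 : ℝ) 1, ‖G 1 - G a‖ ≤ morreyConst n p ρ D I / (1 - n / p) := by
    intro a ha
    have hA : 0 ≤ morreyConst n p ρ D I := by unfold morreyConst; positivity
    have hB : ∀ t > 0, HasDerivAt (fun t => morreyConst n p ρ D I / (1 - n / p) *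
        t ^ (1 - n / p : ℝ)) (morreyConst n p ρ D I * t ^ (-(n / p : ℝ))) t := by
      intro t ht
      refine ((Real.hasDerivAt_rpow_const (p := (1 - n / p : ℝ)) (Or.inl ht.ne')).const_mul
        (morreyConst n p ρ D I / (1 - n / p))).congr_deriv ?_
      rw [show (1 - n / p - 1 : ℝ) = -(n / p) by ring, ← mul_assoc, div_mul_cancel₀ _ hnp.ne']
    have := image_norm_le_of_norm_deriv_right_le_deriv_boundary' (a := a) (b := 1)
      (f := fun t => G t - G a) (f' := H)
      (B := fun t => morreyConst n p ρ D I / (1 - n / p) * t ^ (1 - n / p : ℝ))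
      (B' := fun t => morreyConst n p ρ D I * t ^ (-(n / p : ℝ)))
      (fun t ht => ((hderiv t (ha.1.trans_le ht.1)).continuousAt.sub
        continuousAt_const).continuousWithinAt)
      (fun t ht => ((hderiv t (ha.1.trans_le ht.1)).sub_const _).hasDerivWithinAt)
      (by rw [sub_self, norm_zero]; have := ha.1; positivity)
      (fun t ht => (hB t (ha.1.trans_le ht.1)).continuousAt.continuousWithinAt)
      (fun t ht => (hB t (ha.1.trans_le ht.1)).hasDerivWithinAt)
      (fun t ht => hHbound t ⟨ha.1.trans_le ht.1, ht.2.le⟩)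
      (right_mem_Icc.2 ha.2.le)
    simpa using this
  have h := le_of_tendsto (tendsto_const_nhds.sub hlim).norm
    (by filter_upwards [Ioo_mem_nhdsGT one_pos] with a ha using hinc a ha)
  rwa [hG1, norm_sub_rev] at h

end Morrey

section Dyadic

variable {n : ℕ}

/-- The integer coordinates of the half-open dyadic cube of side `2⁻ᵏ` containing `x`. -/
def dyadicIndex (k : ℕ) (x : EuclideanSpace ℝ (Fin n)) : Fin n → ℤ := fun i => ⌊2 ^ k * x i⌋

/-- The half-open dyadic cube of side `2⁻ᵏ` with integer coordinates `m`. -/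
def dyadicCube (k : ℕ) (m : Fin n → ℤ) : Set (EuclideanSpace ℝ (Fin n)) :=
  {x | dyadicIndex k x = m}

theorem mem_dyadicCube {k : ℕ} {m : Fin n → ℤ} {x : EuclideanSpace ℝ (Fin n)} :
    x ∈ dyadicCube k m ↔ ∀ i, 2 ^ k * x i ∈ Ico (m i : ℝ) (m i + 1) := by
  simp only [dyadicCube, dyadicIndex, mem_ofPred_eq, funext_iff, Int.floor_eq_iff, mem_Ico]

theorem convex_dyadicCube (k : ℕ) (m : Fin n → ℤ) : Convex ℝ (dyadicCube k m) := by
  intro x hx y hy a b ha hb hab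
  rw [mem_dyadicCube] at hx hy ⊢
  intro i
  have := convex_Ico (m i : ℝ) (m i + 1) (hx i) (hy i) ha hb hab
  convert this using 1
  simp
  ring

theorem measurableSet_dyadicCube (k : ℕ) (m : Fin n → ℤ) : MeasurableSet (dyadicCube k m) := by
  have : dyadicCube k m = ⋂ i, {x | 2 ^ k * x i ∈ Ico (m i : ℝ) (m i + 1)} := by
    ext x; simp only [mem_dyadicCube, mem_iInter, mem_ofPred_eq]
  rw [this]
  refine MeasurableSet.iInter fun i => ?_
  exact (by fun_prop : Measurable fun x : EuclideanSpace ℝ (Fin n) => 2 ^ k * x i)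
    measurableSet_Ico

theorem dyadicIndex_eq_div_two (k : ℕ) (x : EuclideanSpace ℝ (Fin n)) (i : Fin n) :
    dyadicIndex k x i = dyadicIndex (k + 1) x i / 2 := by
  have := Int.floor_div_natCast (2 ^ (k + 1) * x i) 2
  push_cast at this
  rw [dyadicIndex, dyadicIndex, ← this]
  congr 1
  ring

theorem dyadicIndex_eq_of_le {k l : ℕ} (hkl : k ≤ l) {x y : EuclideanSpace ℝ (Fin n)}
    (h : dyadicIndex l x = dyadicIndex l y) : dyadicIndex k x = dyadicIndex k y := by
  induction l, hkl using Nat.le_induction with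
  | base => exact h
  | succ l _ ih =>
    refine ih (funext fun i => ?_)
    rw [dyadicIndex_eq_div_two l x, dyadicIndex_eq_div_two l y, h]

theorem norm_sub_le_of_forall_abs_le {x y : EuclideanSpace ℝ (Fin n)} {h : ℝ}
    (hh : 0 ≤ h) (hxy : ∀ i, |x i - y i| ≤ h) : ‖x - y‖ ≤ n * h := by
  rw [EuclideanSpace.norm_eq, Real.sqrt_le_left (by positivity)]
  have h1 : ∑ i, ‖(x - y) i‖ ^ 2 ≤ ∑ _i : Fin n, h ^ 2 := by
    gcongr with i
    exact hxy i
  refine h1.trans ?_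
  have h2 : (n : ℝ) ≤ n * n := by exact_mod_cast Nat.le_mul_self n
  simp only [Finset.sum_const, Finset.card_univ, Fintype.card_fin, nsmul_eq_mul]
  nlinarith [sq_nonneg h]

theorem norm_sub_le_of_mem_dyadicCube {k : ℕ} {m : Fin n → ℤ} {x y : EuclideanSpace ℝ (Fin n)}
    (hx : x ∈ dyadicCube k m) (hy : y ∈ dyadicCube k m) : ‖x - y‖ ≤ n * (2 ^ k)⁻¹ := by
  refine norm_sub_le_of_forall_abs_le (by positivity) fun i => ?_
  have h1 := mem_dyadicCube.1 hx i
  have h2 := mem_dyadicCube.1 hy i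
  have h3 : |2 ^ k * x i - 2 ^ k * y i| ≤ 1 := by
    rw [abs_le]; constructor <;> linarith [h1.1, h1.2, h2.1, h2.2]
  rw [← mul_sub, abs_mul, abs_of_pos (by positivity : (0 : ℝ) < 2 ^ k)] at h3
  rwa [← one_div, le_div_iff₀ (by positivity), mul_comm]

theorem exists_closedBall_subset_dyadicCube (k : ℕ) (m : Fin n → ℤ) :
    ∃ c, closedBall c ((2 ^ k)⁻¹ * (1 / 4)) ⊆ dyadicCube k m := by
  refine ⟨WithLp.toLp 2 fun i => (2 ^ k)⁻¹ * (m i + 1 / 2), fun y hy => ?_⟩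
  rw [mem_dyadicCube]
  intro i
  rw [mem_closedBall, dist_eq_norm] at hy
  have h1 := (PiLp.norm_apply_le _ i).trans hy
  rw [PiLp.sub_apply, Real.norm_eq_abs] at h1
  have h2 : (2 : ℝ) ^ k * |y i - (2 ^ k)⁻¹ * (m i + 1 / 2)| ≤ 1 / 4 := by
    have : (2 : ℝ) ^ k * ((2 ^ k)⁻¹ * (1 / 4)) = 1 / 4 := by field_simp
    rw [← this]
    gcongr
  rw [← abs_of_pos (by positivity : (0 : ℝ) < 2 ^ k), ← abs_mul, mul_sub,
    abs_of_pos (by positivity : (0 : ℝ) < 2 ^ k), mul_inv_cancel_left₀ (by positivity),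
    abs_le] at h2
  constructor <;> linarith [h2.1, h2.2]

theorem dyadicIndex_mem_Icc (k : ℕ) {R : ℝ} {x : EuclideanSpace ℝ (Fin n)} (hx : ‖x‖ ≤ R) :
    dyadicIndex k x ∈ Finset.Icc (fun _ => -⌈2 ^ k * R⌉) (fun _ => ⌈2 ^ k * R⌉) := by
  have hxi (i : Fin n) : |2 ^ k * x i| ≤ 2 ^ k * R := by
    rw [abs_mul, abs_of_pos (by positivity : (0 : ℝ) < 2 ^ k)]
    gcongr
    exact (PiLp.norm_apply_le x i).trans hx
  rw [Finset.mem_Icc]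
  refine ⟨fun i => ?_, fun i => ?_⟩
  · rw [dyadicIndex, Int.le_floor]
    push_cast
    linarith [(abs_le.1 (hxi i)).1, Int.le_ceil (2 ^ k * R)]
  · have := (Int.floor_le (2 ^ k * x i)).trans
      ((abs_le.1 (hxi i)).2.trans (Int.le_ceil (2 ^ k * R)))
    exact Int.cast_le.1 this

theorem card_Icc_const (a b : ℤ) :
    (Finset.Icc (fun _ : Fin n => a) (fun _ => b)).card = (b + 1 - a).toNat ^ n := by
  simp [Pi.card_Icc]

theorem finite_dyadicIndex_image {E : Set (EuclideanSpace ℝ (Fin n))}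
    (hE : Bornology.IsBounded E) (k : ℕ) : (dyadicIndex k '' E).Finite := by
  obtain ⟨R, hR⟩ := hE.exists_norm_le
  refine (Finset.finite_toSet (Finset.Icc (fun _ : Fin n => -⌈2 ^ k * R⌉)
    (fun _ => ⌈2 ^ k * R⌉))).subset ?_
  rintro _ ⟨x, hx, rfl⟩
  exact dyadicIndex_mem_Icc k (hR x hx)

theorem dyadicIndex_mem_Icc_of_dist_le {k : ℕ} {x y : EuclideanSpace ℝ (Fin n)}
    (h : dist y x ≤ (2 ^ k)⁻¹) :
    dyadicIndex k y ∈ Finset.Icc (dyadicIndex k x - 1) (dyadicIndex k x + 1) := by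
  have hi (i : Fin n) : |2 ^ k * y i - 2 ^ k * x i| ≤ 1 := by
    rw [← mul_sub, abs_mul, abs_of_pos (by positivity : (0 : ℝ) < 2 ^ k)]
    have := (PiLp.norm_apply_le (y - x) i).trans ((dist_eq_norm y x).symm.trans_le h)
    rw [PiLp.sub_apply, Real.norm_eq_abs] at this
    calc _ ≤ (2 : ℝ) ^ k * (2 ^ k)⁻¹ := by gcongr
      _ = 1 := by field_simp
  rw [Finset.mem_Icc]
  refine ⟨fun i => ?_, fun i => ?_⟩
  · simp only [dyadicIndex, Pi.sub_apply, Pi.one_apply]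
    rw [Int.le_floor]
    push_cast
    linarith [(abs_le.1 (hi i)).1, Int.floor_le (2 ^ k * x i)]
  · simp only [dyadicIndex, Pi.add_apply, Pi.one_apply]
    rw [← Int.lt_add_one_iff, Int.floor_lt]
    push_cast
    linarith [(abs_le.1 (hi i)).2, Int.lt_floor_add_one (2 ^ k * x i)]

theorem card_Icc_sub_one_add_one (m : Fin n → ℤ) : (Finset.Icc (m - 1) (m + 1)).card = 3 ^ n := by
  have (i : Fin n) : m i + 1 + 1 - (m i - 1) = 3 := by ring
  simp [Pi.card_Icc, this]

theorem card_Icc_two_mul (m : Fin n → ℤ) :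
    (Finset.Icc (2 * m) (2 * m + 1)).card = 2 ^ n := by
  have (i : Fin n) : 2 * m i + 1 + 1 - 2 * m i = 2 := by ring
  simp [Pi.card_Icc, this]

theorem dyadicIndex_succ_mem_Icc (k : ℕ) (x : EuclideanSpace ℝ (Fin n)) :
    dyadicIndex (k + 1) x ∈ Finset.Icc (2 * dyadicIndex k x) (2 * dyadicIndex k x + 1) := by
  rw [Finset.mem_Icc]
  refine ⟨fun i => ?_, fun i => ?_⟩ <;>
  · have := dyadicIndex_eq_div_two k x i
    simp only [Pi.mul_apply, Pi.add_apply, Pi.ofNat_apply]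
    omega

/-- Distinct cubes of one generation are disjoint, so their total mass is at most the mass of the
space. -/
theorem sum_measureReal_dyadicCube_le (ν : Measure (EuclideanSpace ℝ (Fin n))) [IsFiniteMeasure ν]
    {S : Finset (ℕ × (Fin n → ℤ))}
    (hS : (S : Set (ℕ × (Fin n → ℤ))).PairwiseDisjoint fun q => dyadicCube q.1 q.2) :
    ∑ q ∈ S, ν.real (dyadicCube q.1 q.2) ≤ ν.real univ := by
  rw [← measureReal_biUnion_finset hS fun q _ => measurableSet_dyadicCube q.1 q.2]
  exact measureReal_mono (subset_univ _)

end Dyadic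

section Oscillation

variable {n N : ℕ}

theorem morreyConst_mul_mul {h p ρ D I : ℝ} (hn : 0 < n) (hh : 0 < h) (hρ : 0 < ρ) :
    morreyConst n p (h * ρ) (h * D) I =
      morreyConst n p ρ D 1 * h ^ (1 - n / p : ℝ) * I ^ (1 / p) := by
  have : Nonempty (Fin n) := ⟨⟨0, hn⟩⟩
  set ω := volume.real (ball (0 : EuclideanSpace ℝ (Fin n)) 1) with hω
  have hω0 : 0 < ω := ENNReal.toReal_pos (measure_ball_pos _ _ one_pos).ne' measure_ball_lt_top.ne
  have e1 (r : ℝ) (hr : 0 ≤ r) :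
      volume.real (closedBall (0 : EuclideanSpace ℝ (Fin n)) r) = r ^ n * ω := by
    rw [Measure.addHaar_real_closedBall _ _ hr, finrank_euclideanSpace, Fintype.card_fin]
  unfold morreyConst
  rw [e1 _ (by positivity), e1 _ (by positivity), e1 _ (by positivity), e1 _ (by positivity)]
  have h5 : (h ^ n : ℝ) ^ (1 - 1 / p) * h = h ^ n * h ^ (1 - n / p : ℝ) := by
    rw [← Real.rpow_natCast, ← Real.rpow_mul hh.le]
    nth_rw 2 [← Real.rpow_one h]
    rw [← Real.rpow_add hh, ← Real.rpow_add hh]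
    congr 1; ring
  rw [mul_pow h ρ, mul_assoc (h ^ n), Real.mul_rpow (x := h ^ n) (by positivity) (by positivity),
    Real.one_rpow, mul_one]
  have h6 : (h * ρ / 2) ^ n = h ^ n * (ρ / 2) ^ n := by rw [← mul_pow]; ring
  rw [h6]
  calc _ = ((h ^ n * (ρ / 2) ^ n) * ω)⁻¹ * D * ((h ^ n) ^ (1 - 1 / p) * h) *
        ((ρ ^ n * ω) ^ (1 - 1 / p) * I ^ (1 / p)) := by ring
    _ = _ := by
      rw [h5]
      field_simp

/-- Supercritical Sobolev maps have oscillation on small dyadic cubes controlled by a finite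
measure. -/
theorem MemW1p.exists_dist_le (hn : 0 < n) {Ω : Set (EuclideanSpace ℝ (Fin n))} (hΩ : IsOpen Ω)
    {p : ℝ} (hp : n < p) {f : EuclideanSpace ℝ (Fin n) → EuclideanSpace ℝ (Fin N)}
    (hfc : ContinuousOn f Ω) (hf : MemW1p n N p Ω f)
    {E : Set (EuclideanSpace ℝ (Fin n))} (hEc : IsCompact E) (hE : E ⊆ Ω) :
    ∃ (ν : Measure (EuclideanSpace ℝ (Fin n))) (_ : IsFiniteMeasure ν) (C : ℝ) (l : ℕ), 0 ≤ C ∧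
      ∀ k ≥ l, ∀ x ∈ E, ∀ y ∈ E, dyadicIndex k y = dyadicIndex k x → dist (f y) (f x) ≤
        C * ((2 ^ k)⁻¹ : ℝ) ^ (1 - n / p : ℝ) *
          ν.real (dyadicCube k (dyadicIndex k x)) ^ (1 / p) := by
  obtain ⟨Df, hD, hfin, hw⟩ := hf
  have hn1 : (1 : ℝ) ≤ n := by exact_mod_cast hn
  have hp0 : 0 < p := by linarith
  have hnp : 0 < 1 - n / p := by rw [sub_pos, div_lt_one hp0]; exact hp
  obtain ⟨δ, hδ, hδΩ⟩ := hEc.exists_cthickening_subset_open hΩ hE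
  obtain ⟨l, hl⟩ := exists_pow_lt_of_lt_one (show 0 < δ / n by positivity)
    (show (2⁻¹ : ℝ) < 1 by norm_num)
  set ν := (volume.restrict Ω).withDensity fun x => ENNReal.ofReal (‖Df x‖ ^ p) with hν
  have hνf : IsFiniteMeasure ν := isFiniteMeasure_withDensity hfin.ne
  refine ⟨ν, hνf, 2 * (morreyConst n p (1 / 4) n 1 / (1 - n / p)), l, ?_, ?_⟩
  · unfold morreyConst; positivity
  intro k hk x hx y _ hyx
  set m := dyadicIndex k x
  have hxm : x ∈ dyadicCube k m := rfl
  have hkδ : n * ((2 ^ k)⁻¹ : ℝ) ≤ δ := by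
    have h1 : ((2 ^ k)⁻¹ : ℝ) ≤ 2⁻¹ ^ l := by
      rw [inv_pow]; gcongr; norm_num
    have := (lt_div_iff₀ (by positivity)).1 (h1.trans_lt hl)
    linarith
  have hQΩ : dyadicCube k m ⊆ Ω := fun z hz => hδΩ <| mem_cthickening_of_dist_le z x δ E hx <| by
    rw [dist_eq_norm]; exact (norm_sub_le_of_mem_dyadicCube hz hxm).trans hkδ
  have hνQ : ν (dyadicCube k m) = ∫⁻ z in dyadicCube k m, ENNReal.ofReal (‖Df z‖ ^ p) := by
    rw [hν, withDensity_apply _ (measurableSet_dyadicCube k m),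
      Measure.restrict_restrict (measurableSet_dyadicCube k m), inter_eq_left.2 hQΩ]
  obtain ⟨c, hc⟩ := exists_closedBall_subset_dyadicCube k m
  obtain ⟨a, ha⟩ := IsWeakDeriv.exists_norm_sub_le hw hΩ hfc hD hn hp (convex_dyadicCube k m)
    hQΩ (ρ := (2 ^ k)⁻¹ * (1 / 4)) (D := (2 ^ k)⁻¹ * n) (by positivity) hc
    (fun z hz w hw => (norm_sub_le_of_mem_dyadicCube (hc hw) hz).trans_eq (mul_comm _ _))
    (by rw [← hνQ]; exact measure_ne_top ν _)
  rw [← hνQ, ← measureReal_def, morreyConst_mul_mul hn (by positivity) (by norm_num)] at ha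
  have h1 := ha x hxm
  have h2 := ha y hyx
  calc dist (f y) (f x) ≤ ‖f y - a‖ + ‖f x - a‖ := by
        rw [← dist_eq_norm, ← dist_eq_norm]; exact dist_triangle_right _ _ _
    _ ≤ _ := (add_le_add h2 h1).trans_eq (by ring)

end Oscillation

section InterCover

theorem sum_union_le_of_nonneg {ι : Type*} [DecidableEq ι] {s t : Finset ι} {g : ι → ℝ}
    (hg : ∀ i, 0 ≤ g i) : ∑ i ∈ s ∪ t, g i ≤ ∑ i ∈ s, g i + ∑ i ∈ t, g i := by
  rw [← Finset.sum_union_inter]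
  exact le_add_of_nonneg_right (Finset.sum_nonneg fun i _ => hg i)

theorem sum_biUnion_le_of_nonneg {ι κ : Type*} [DecidableEq ι] (s : Finset κ) (t : κ → Finset ι)
    {g : ι → ℝ} (hg : ∀ i, 0 ≤ g i) : ∑ i ∈ s.biUnion t, g i ≤ ∑ k ∈ s, ∑ i ∈ t k, g i := by
  classical
  induction s using Finset.induction_on with
  | empty => simp
  | insert a s ha ih =>
    rw [Finset.biUnion_insert, Finset.sum_insert ha]
    exact (sum_union_le_of_nonneg hg).trans (by gcongr)

/-- The exponents `s` allowed in the definition of `interDim θ E`. -/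
def HasInterCover {X : Type*} [MetricSpace X] (θ : ℝ) (E : Set X) (s : ℝ) : Prop :=
  0 < s ∧ ∃ C : ℝ, 0 < C ∧ ∃ δ₀ : ℝ, 0 < δ₀ ∧ ∀ δ : ℝ, 0 < δ → δ < δ₀ →
    ∃ (J : Finset ℕ) (A : ℕ → Set X), (E ⊆ ⋃ i ∈ J, A i) ∧
      (∀ i ∈ J, δ ^ (1/θ) ≤ Metric.diam (A i) ∧ Metric.diam (A i) ≤ δ) ∧
      (∑ i ∈ J, Metric.diam (A i) ^ s) ≤ C

theorem interDim_eq_sInf {X : Type*} [MetricSpace X] (θ : ℝ) (E : Set X) :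
    interDim θ E = sInf {s | HasInterCover θ E s} := rfl

theorem interDim_nonneg {X : Type*} [MetricSpace X] (θ : ℝ) (E : Set X) : 0 ≤ interDim θ E :=
  Real.sInf_nonneg fun _ hs => hs.1.le

theorem HasInterCover.interDim_le {X : Type*} [MetricSpace X] {θ s : ℝ} {E : Set X}
    (h : HasInterCover θ E s) : interDim θ E ≤ s :=
  csInf_le ⟨0, fun _ hs => hs.1.le⟩ h

/-- To bound the intermediate dimension it suffices to cover by closed balls indexed by an
arbitrary encodable type. -/
theorem HasInterCover.of_closedBall {X : Type*} [NormedAddCommGroup X] [NormedSpace ℝ X]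
    [Nontrivial X] {ι : Type*} [Encodable ι] {θ s : ℝ} {E : Set X} (hs : 0 < s) (C : ℝ)
    {δ₀ : ℝ} (hδ₀ : 0 < δ₀)
    (h : ∀ δ : ℝ, 0 < δ → δ < δ₀ → ∃ (I : Finset ι) (c : ι → X) (r : ι → ℝ),
      (∀ x ∈ E, ∃ i ∈ I, dist x (c i) ≤ r i) ∧
      (∀ i ∈ I, δ ^ (1 / θ) ≤ 2 * r i ∧ 2 * r i ≤ δ) ∧ ∑ i ∈ I, (2 * r i) ^ s ≤ C) :
    HasInterCover θ E s := by
  refine ⟨hs, |C| + 1, by positivity, δ₀, hδ₀, fun δ hδ hδδ₀ => ?_⟩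
  obtain ⟨I, c, r, hE, hr, hC⟩ := h δ hδ hδδ₀
  have hd (i) (hi : i ∈ I) : diam (closedBall (c i) (r i)) = 2 * r i :=
    diam_closedBall_eq _ (by have := (Real.rpow_pos_of_pos hδ (1 / θ)).trans_le (hr i hi).1; linarith)
  refine ⟨I.map ⟨Encodable.encode, Encodable.encode_injective⟩,
    fun j => (Encodable.decode (α := ι) j).elim ∅ fun i => closedBall (c i) (r i), ?_, ?_, ?_⟩
  · intro x hx
    obtain ⟨i, hi, hxi⟩ := hE x hx
    refine mem_biUnion (x := Encodable.encode i) (Finset.mem_map_of_mem _ hi) ?_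
    simpa [Encodable.encodek] using hxi
  · simp only [Finset.forall_mem_map, Function.Embedding.coeFn_mk, Encodable.encodek, Option.elim]
    intro i hi
    rw [hd i hi]
    exact hr i hi
  · simp only [Finset.sum_map, Function.Embedding.coeFn_mk, Encodable.encodek, Option.elim]
    rw [Finset.sum_congr rfl fun i hi => by rw [hd i hi]]
    linarith [le_abs_self C]

variable {n : ℕ}

theorem exists_dyadic_near {δ : ℝ} (hδ : 0 < δ) (hδ1 : δ ≤ 1) :
    ∃ k : ℕ, δ ≤ (2 ^ k)⁻¹ ∧ (2 ^ k : ℝ)⁻¹ < 2 * δ := by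
  obtain ⟨k, hk, hk'⟩ := exists_nat_pow_near_of_lt_one hδ hδ1 (show (0 : ℝ) < 2⁻¹ by norm_num)
    (by norm_num)
  rw [pow_succ] at hk
  rw [inv_pow] at hk hk'
  exact ⟨k, hk', by linarith⟩

theorem le_of_inv_two_pow_lt {k l : ℕ} (h : (2 ^ k : ℝ)⁻¹ < 2 * (2 ^ l)⁻¹) : l ≤ k := by
  have h1 : (2 : ℝ) ^ l < 2 ^ (k + 1) := by
    rw [pow_succ]
    have : (2 : ℝ) ^ k * 2 ^ l * (2 ^ k)⁻¹ < 2 ^ k * 2 ^ l * (2 * (2 ^ l)⁻¹) := by gcongr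
    field_simp at this
    linarith
  have := (pow_lt_pow_iff_right₀ (one_lt_two (α := ℝ))).1 h1
  omega

open Classical in
/-- A point of `E` in the dyadic cube `q`, or a junk value if there is none. -/
def dyadicPoint (E : Set (EuclideanSpace ℝ (Fin n))) (q : ℕ × (Fin n → ℤ)) :
    EuclideanSpace ℝ (Fin n) :=
  if h : ∃ x ∈ E, dyadicIndex q.1 x = q.2 then h.choose else 0

theorem dyadicPoint_spec {E : Set (EuclideanSpace ℝ (Fin n))} {x : EuclideanSpace ℝ (Fin n)}
    (hx : x ∈ E) (k : ℕ) : dyadicPoint E (k, dyadicIndex k x) ∈ E ∧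
      dyadicIndex k (dyadicPoint E (k, dyadicIndex k x)) = dyadicIndex k x := by
  have h : ∃ y ∈ E, dyadicIndex k y = dyadicIndex k x := ⟨x, hx, rfl⟩
  rw [dyadicPoint, dif_pos h]
  exact h.choose_spec

/-- The intermediate dimensions of a bounded set are at most the dimension of the space. -/
theorem hasInterCover_of_isBounded (hn : 0 < n) {θ : ℝ} (hθ0 : 0 < θ) (hθ1 : θ < 1)
    {E : Set (EuclideanSpace ℝ (Fin n))} (hE : Bornology.IsBounded E) :
    HasInterCover θ E n := by
  have : Nonempty (Fin n) := ⟨⟨0, hn⟩⟩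
  have : Nontrivial (EuclideanSpace ℝ (Fin n)) :=
    Module.nontrivial_of_finrank_pos (R := ℝ) (by simpa using hn)
  have hn1 : (1 : ℝ) ≤ n := by exact_mod_cast hn
  obtain ⟨R, hR0, hR⟩ := hE.exists_pos_norm_le
  refine HasInterCover.of_closedBall (ι := ℕ × (Fin n → ℤ)) (by positivity)
    ((8 * n * R + 3) ^ n) one_pos fun δ hδ hδ1 => ?_
  have hle : δ / (2 * n) / 2 ≤ 1 := by
    rw [div_div, div_le_one (by positivity)]; linarith
  obtain ⟨k, hk, hk'⟩ := exists_dyadic_near (δ := δ / (2 * n) / 2) (by positivity) hle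
  set a := ⌈2 ^ k * R⌉ with ha
  have ha0 : 0 ≤ a := Int.ceil_nonneg (by positivity)
  refine ⟨{k} ×ˢ Finset.Icc (fun _ => -a) (fun _ => a), dyadicPoint E, fun _ => δ / 2, ?_, ?_, ?_⟩
  · intro x hx
    refine ⟨(k, dyadicIndex k x), by simpa using dyadicIndex_mem_Icc k (hR x hx), ?_⟩
    have := norm_sub_le_of_mem_dyadicCube (k := k) (m := dyadicIndex k x) (x := x) rfl
      (dyadicPoint_spec hx k).2
    rw [dist_eq_norm]
    calc _ ≤ n * (2 ^ k : ℝ)⁻¹ := this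
      _ ≤ n * (2 * (δ / (2 * n) / 2)) := by gcongr
      _ = δ / 2 := by field_simp
  · intro i _
    have : δ ^ (1 / θ) ≤ δ := by
      conv_rhs => rw [← Real.rpow_one δ]
      exact Real.rpow_le_rpow_of_exponent_ge hδ hδ1.le ((one_le_div hθ0).2 hθ1.le)
    constructor <;> linarith
  · have hcard : ((2 * a + 1).toNat : ℝ) ≤ 2 * (2 ^ k * R) + 3 := by
      have h1 : ((2 * a + 1).toNat : ℝ) = 2 * a + 1 := by
        exact_mod_cast congrArg (Int.cast (R := ℝ)) (Int.toNat_of_nonneg (by omega : 0 ≤ 2 * a + 1))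
      rw [h1]
      linarith [Int.ceil_lt_add_one (2 ^ k * R)]
    have hδk : (2 : ℝ) ^ k * δ ≤ 4 * n := by
      have : (2 : ℝ) ^ k * (δ / (2 * n) / 2) ≤ 2 ^ k * (2 ^ k)⁻¹ := by gcongr
      rw [mul_inv_cancel₀ (by positivity), div_div, ← mul_div_assoc,
        div_le_one (by positivity)] at this
      linarith
    rw [Finset.sum_const, Finset.card_product, Finset.card_singleton, card_Icc_const, one_mul,
      nsmul_eq_mul, mul_div_cancel₀ _ (two_ne_zero), Real.rpow_natCast,
      show a + 1 - -a = 2 * a + 1 by ring]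
    push_cast
    rw [← mul_pow]
    gcongr
    calc _ ≤ (2 * (2 ^ k * R) + 3) * δ := by gcongr
      _ = 2 * R * (2 ^ k * δ) + 3 * δ := by ring
      _ ≤ 2 * R * (4 * n) + 3 * 1 := by gcongr
      _ = _ := by ring

end InterCover

section DyadicCovers

variable {n : ℕ}

/-- Covers with controlled diameters can be replaced by covers by dyadic cubes. -/
theorem HasInterCover.exists_dyadic {θ s : ℝ} {E : Set (EuclideanSpace ℝ (Fin n))}
    (h : HasInterCover θ E s) : ∃ C δ₀ : ℝ, 0 < δ₀ ∧ ∀ δ : ℝ, 0 < δ → δ < δ₀ →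
      ∃ (F : Finset (ℕ × (Fin n → ℤ))), (∀ x ∈ E, ∃ k, (k, dyadicIndex k x) ∈ F) ∧
        (∀ q ∈ F, δ ^ (1 / θ) ≤ (2 ^ q.1 : ℝ)⁻¹ ∧ (2 ^ q.1 : ℝ)⁻¹ < 2 * δ) ∧
        ∑ q ∈ F, ((2 ^ q.1)⁻¹ : ℝ) ^ s ≤ C := by
  classical
  obtain ⟨hs, C, hC, δ₀, hδ₀, h⟩ := h
  refine ⟨3 ^ n * 2 ^ s * C, min δ₀ 1, by positivity, fun δ hδ hδδ₀ => ?_⟩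
  obtain ⟨J, A, hEA, hA, hsum⟩ := h δ hδ (hδδ₀.trans_le (min_le_left _ _))
  have hpos (i) (hi : i ∈ J) : 0 < diam (A i) := (Real.rpow_pos_of_pos hδ _).trans_le (hA i hi).1
  have hk (i) (hi : i ∈ J) : ∃ k : ℕ, diam (A i) ≤ (2 ^ k)⁻¹ ∧ (2 ^ k : ℝ)⁻¹ < 2 * diam (A i) :=
    exists_dyadic_near (hpos i hi) ((hA i hi).2.trans (hδδ₀.trans_le (min_le_right _ _)).le)
  choose! k hk1 hk2 using hk
  have ha (i) : (A i ∩ E).Nonempty → ∃ a, a ∈ A i ∩ E := id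
  choose! a ha using ha
  let cubes (i : ℕ) : Finset (ℕ × (Fin n → ℤ)) :=
    {k i} ×ˢ Finset.Icc (dyadicIndex (k i) (a i) - 1) (dyadicIndex (k i) (a i) + 1)
  refine ⟨J.biUnion cubes, fun x hx => ?_, fun q hq => ?_, ?_⟩
  · obtain ⟨i, hi, hxi⟩ := mem_iUnion₂.1 (hEA hx)
    refine ⟨k i, Finset.mem_biUnion.2 ⟨i, hi, ?_⟩⟩
    have hb : Bornology.IsBounded (A i) := by
      by_contra hb
      exact (hpos i hi).ne' (diam_eq_zero_of_unbounded hb)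
    refine Finset.mem_product.2 ⟨Finset.mem_singleton_self _, dyadicIndex_mem_Icc_of_dist_le ?_⟩
    exact (dist_le_diam_of_mem hb hxi (ha i ⟨x, hxi, hx⟩).1).trans (hk1 i hi)
  · obtain ⟨i, hi, hq⟩ := Finset.mem_biUnion.1 hq
    rw [Finset.mem_singleton.1 (Finset.mem_product.1 hq).1]
    exact ⟨(hA i hi).1.trans (hk1 i hi), (hk2 i hi).trans_le (by linarith [(hA i hi).2])⟩
  · calc _ ≤ ∑ i ∈ J, ∑ q ∈ cubes i, ((2 ^ q.1)⁻¹ : ℝ) ^ s :=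
          sum_biUnion_le_of_nonneg _ _ fun q => by positivity
      _ ≤ ∑ i ∈ J, 3 ^ n * 2 ^ s * diam (A i) ^ s := by
          refine Finset.sum_le_sum fun i hi => ?_
          rw [Finset.sum_product, Finset.sum_singleton]
          simp only [Finset.sum_const, card_Icc_sub_one_add_one, nsmul_eq_mul, Nat.cast_pow,
            Nat.cast_ofNat]
          rw [mul_assoc, ← Real.mul_rpow (by norm_num) (hpos i hi).le]
          gcongr
          exact (hk2 i hi).le
      _ ≤ _ := by
          rw [← Finset.mul_sum]
          gcongr

/-- The cubes of a family that are maximal among the cubes of the family containing a given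
point are pairwise disjoint. -/
theorem pairwiseDisjoint_of_maximal {F : Set (ℕ × (Fin n → ℤ))}
    {G : Set (ℕ × (Fin n → ℤ))} (hGF : G ⊆ F)
    (hG : ∀ q ∈ G, ∃ x, dyadicIndex q.1 x = q.2 ∧ ∀ j < q.1, (j, dyadicIndex j x) ∉ F) :
    G.PairwiseDisjoint fun q => dyadicCube q.1 q.2 := by
  have key (q) (hq : q ∈ G) (r) (hr : r ∈ G) (z) (hzq : dyadicIndex q.1 z = q.2)
      (hzr : dyadicIndex r.1 z = r.2) : r.1 ≤ q.1 := by
    by_contra! hlt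
    obtain ⟨x, hx, hxF⟩ := hG r hr
    refine hxF q.1 hlt ?_
    rw [dyadicIndex_eq_of_le hlt.le (hx.trans hzr.symm), hzq]
    exact hGF hq
  intro q hq r hr hqr
  refine Set.disjoint_left.2 fun z hzq hzr => hqr ?_
  have h1 : q.1 = r.1 := le_antisymm (key r hr q hq z hzr hzq) (key q hq r hr z hzq hzr)
  refine Prod.ext h1 ?_
  rw [← show _ = q.2 from hzq, ← show _ = r.2 from hzr, h1]

/-- The bound `C h^{1-n/p} ν(Q)^{1/p}` for the oscillation on the dyadic cube `q`. -/
def oscBound (p C : ℝ) (ν : Measure (EuclideanSpace ℝ (Fin n))) (q : ℕ × (Fin n → ℤ)) : ℝ :=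
  C * ((2 ^ q.1)⁻¹ : ℝ) ^ (1 - n / p : ℝ) * ν.real (dyadicCube q.1 q.2) ^ (1 / p)

variable {p C : ℝ} {ν : Measure (EuclideanSpace ℝ (Fin n))}

theorem oscBound_nonneg (hC : 0 ≤ C) (q : ℕ × (Fin n → ℤ)) : 0 ≤ oscBound p C ν q := by
  unfold oscBound; positivity

theorem two_mul_oscBound_rpow (hC : 0 ≤ C) (q : ℕ × (Fin n → ℤ)) (t : ℝ) :
    (2 * oscBound p C ν q) ^ t = (2 * C) ^ t * ((2 ^ q.1)⁻¹ : ℝ) ^ ((1 - n / p) * t) *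
      ν.real (dyadicCube q.1 q.2) ^ (t / p) := by
  rw [oscBound, ← mul_assoc, ← mul_assoc, Real.mul_rpow (by positivity) (by positivity),
    Real.mul_rpow (by positivity) (by positivity), ← Real.rpow_mul (by positivity),
    ← Real.rpow_mul (by positivity), one_div_mul_eq_div]

theorem card_mul_rpow_le [IsFiniteMeasure ν] (hp : 0 < p) (hC : 0 ≤ C) {η : ℝ} (hη : 0 ≤ η) {k : ℕ}
    {S : Finset (Fin n → ℤ)} (hS : ∀ m ∈ S, η < 2 * oscBound p C ν (k, m)) :
    S.card * η ^ p ≤ (2 * C) ^ p * ν.real univ * ((2 ^ k)⁻¹ : ℝ) ^ (p - n) := by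
  classical
  have hd : (({k} ×ˢ S : Finset (ℕ × (Fin n → ℤ))) : Set (ℕ × (Fin n → ℤ))).PairwiseDisjoint
      fun q => dyadicCube q.1 q.2 := by
    rintro ⟨_, m⟩ hm ⟨_, m'⟩ hm' hne
    simp only [Finset.coe_product, Finset.coe_singleton, mem_prod, mem_singleton_iff] at hm hm'
    obtain ⟨rfl, -⟩ := hm
    obtain ⟨rfl, -⟩ := hm'
    refine Set.disjoint_left.2 fun z hz hz' => hne ?_
    rw [← show _ = m from hz, ← show _ = m' from hz']
  have hsum := sum_measureReal_dyadicCube_le ν hd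
  rw [Finset.sum_product, Finset.sum_singleton] at hsum
  calc S.card * η ^ p = ∑ m ∈ S, η ^ p := by rw [Finset.sum_const, nsmul_eq_mul]
    _ ≤ ∑ m ∈ S, (2 * C) ^ p * ((2 ^ k)⁻¹ : ℝ) ^ (p - n) * ν.real (dyadicCube k m) := by
        refine Finset.sum_le_sum fun m hm => ?_
        refine (Real.rpow_le_rpow hη (hS m hm).le hp.le).trans_eq ?_
        rw [two_mul_oscBound_rpow hC, div_self hp.ne', Real.rpow_one]
        congr 3
        field_simp
    _ = (2 * C) ^ p * ((2 ^ k)⁻¹ : ℝ) ^ (p - n) * ∑ m ∈ S, ν.real (dyadicCube k m) := by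
        rw [Finset.mul_sum]
    _ ≤ (2 * C) ^ p * ((2 ^ k)⁻¹ : ℝ) ^ (p - n) * ν.real univ := by gcongr
    _ = _ := by ring

theorem inv_two_pow_rpow (k : ℕ) (a : ℝ) : ((2 ^ k)⁻¹ : ℝ) ^ a = ((2 : ℝ)⁻¹ ^ a) ^ k := by
  rw [← inv_pow, ← Real.rpow_natCast, ← Real.rpow_natCast, ← Real.rpow_mul (by norm_num),
    ← Real.rpow_mul (by norm_num), mul_comm]

theorem exists_forall_two_mul_oscBound_le [IsFiniteMeasure ν] (hp0 : 0 < p) (hp : n < p)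
    (hC : 0 ≤ C) {η : ℝ} (hη : 0 < η) :
    ∃ K : ℕ, ∀ k ≥ K, ∀ m, 2 * oscBound p C ν (k, m) ≤ η := by
  have hr : (2 : ℝ)⁻¹ ^ (p - n) < 1 :=
    Real.rpow_lt_one (by norm_num) (by norm_num) (sub_pos.2 hp)
  have hlim := (tendsto_pow_atTop_nhds_zero_of_lt_one (by positivity) hr).const_mul
    ((2 * C) ^ p * ν.real univ)
  rw [mul_zero] at hlim
  obtain ⟨K, hK⟩ := eventually_atTop.1 (hlim.eventually_lt_const (Real.rpow_pos_of_pos hη p))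
  refine ⟨K, fun k hk m => ?_⟩
  by_contra! hlt
  have := card_mul_rpow_le hp0 hC hη.le (S := {m}) (k := k) (by simpa using hlt)
  rw [inv_two_pow_rpow, Finset.card_singleton, Nat.cast_one, one_mul] at this
  exact (hK k hk).not_ge this

/-- There are few cubes that are good (the oscillation bound is at most `η`) but whose parent
is bad. -/
theorem exists_children_of_bad [IsFiniteMeasure ν] (hp0 : 0 < p) (hp : n < p)
    (hC : 0 ≤ C) {η : ℝ} (hη : 0 < η) {E : Set (EuclideanSpace ℝ (Fin n))}
    (hE : Bornology.IsBounded E) (k₀ : ℕ) :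
    ∃ G : Finset (ℕ × (Fin n → ℤ)), (∀ q ∈ G, k₀ ≤ q.1 ∧ 2 * oscBound p C ν q ≤ η) ∧
      (∀ x ∈ E, ∀ k ≥ k₀, η < 2 * oscBound p C ν (k, dyadicIndex k x) →
        2 * oscBound p C ν (k + 1, dyadicIndex (k + 1) x) ≤ η →
        (k + 1, dyadicIndex (k + 1) x) ∈ G) ∧
      G.card * η ^ p ≤ 2 ^ n * ((2 * C) ^ p * ν.real univ) / (1 - 2⁻¹ ^ (p - n)) *
        ((2 ^ k₀)⁻¹ : ℝ) ^ (p - n) := by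
  classical
  obtain ⟨K, hK⟩ := exists_forall_two_mul_oscBound_le (ν := ν) hp0 hp hC hη
  let bad (k : ℕ) : Finset (Fin n → ℤ) :=
    (finite_dyadicIndex_image hE k).toFinset.filter fun m => η < 2 * oscBound p C ν (k, m)
  let children (k : ℕ) : Finset (ℕ × (Fin n → ℤ)) :=
    {k + 1} ×ˢ (bad k).biUnion fun m => Finset.Icc (2 * m) (2 * m + 1)
  refine ⟨((Finset.Ico k₀ K).biUnion children).filter fun q => 2 * oscBound p C ν q ≤ η,
    fun q hq => ?_, fun x hx k hk hbad hgood => ?_, ?_⟩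
  · rw [Finset.mem_filter, Finset.mem_biUnion] at hq
    obtain ⟨⟨k, hk, hq⟩, hg⟩ := hq
    rw [Finset.mem_product, Finset.mem_singleton] at hq
    exact ⟨by have := (Finset.mem_Ico.1 hk).1; omega, hg⟩
  · have hkK : k < K := by
      by_contra! hle
      exact (hK k hle _).not_gt hbad
    refine Finset.mem_filter.2 ⟨Finset.mem_biUnion.2 ⟨k, Finset.mem_Ico.2 ⟨hk, hkK⟩, ?_⟩, hgood⟩
    refine Finset.mem_product.2 ⟨Finset.mem_singleton_self _, Finset.mem_biUnion.2
      ⟨dyadicIndex k x, Finset.mem_filter.2 ⟨?_, hbad⟩, dyadicIndex_succ_mem_Icc k x⟩⟩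
    exact (Set.Finite.mem_toFinset _).2 (mem_image_of_mem _ hx)
  · have hr : (2 : ℝ)⁻¹ ^ (p - n) < 1 :=
      Real.rpow_lt_one (by norm_num) (by norm_num) (sub_pos.2 hp)
    have hcard : (((Finset.Ico k₀ K).biUnion children).filter
        fun q => 2 * oscBound p C ν q ≤ η).card ≤ ∑ k ∈ Finset.Ico k₀ K, (bad k).card * 2 ^ n := by
      refine (Finset.card_filter_le _ _).trans (Finset.card_biUnion_le.trans ?_)
      refine Finset.sum_le_sum fun k _ => ?_
      rw [Finset.card_product, Finset.card_singleton, one_mul]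
      exact Finset.card_biUnion_le_card_mul _ _ _ fun m _ => (card_Icc_two_mul m).le
    calc _ ≤ ((∑ k ∈ Finset.Ico k₀ K, (bad k).card * 2 ^ n : ℕ) : ℝ) * η ^ p := by gcongr
      _ = ∑ k ∈ Finset.Ico k₀ K, 2 ^ n * ((bad k).card * η ^ p) := by
          push_cast
          rw [Finset.sum_mul]
          exact Finset.sum_congr rfl fun k _ => by ring
      _ ≤ ∑ k ∈ Finset.Ico k₀ K, 2 ^ n * ((2 * C) ^ p * ν.real univ * (2⁻¹ ^ (p - n)) ^ k) := by
          refine Finset.sum_le_sum fun k _ => mul_le_mul_of_nonneg_left ?_ (by positivity)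
          rw [← inv_two_pow_rpow]
          exact card_mul_rpow_le hp0 hC hη.le fun m hm => (Finset.mem_filter.1 hm).2
      _ = 2 ^ n * ((2 * C) ^ p * ν.real univ) * ∑ k ∈ Finset.Ico k₀ K, (2⁻¹ ^ (p - n)) ^ k := by
          rw [Finset.mul_sum]
          exact Finset.sum_congr rfl fun k _ => by ring
      _ ≤ 2 ^ n * ((2 * C) ^ p * ν.real univ) *
            ((2⁻¹ ^ (p - n)) ^ k₀ / (1 - 2⁻¹ ^ (p - n))) := by
          gcongr
          exact geom_sum_Ico_le_of_lt_one (by positivity) hr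
      _ = _ := by rw [inv_two_pow_rpow]; ring

end DyadicCovers

section Distortion

variable {n N : ℕ} {p s : ℝ}

/-- Young's inequality for the oscillation bounds at the exponent `p s / (p - n + s)`. -/
theorem two_mul_oscBound_rpow_le (hn : n < p) (hs : 0 < s) {C : ℝ} (hC : 0 ≤ C)
    (ν : Measure (EuclideanSpace ℝ (Fin n))) (q : ℕ × (Fin n → ℤ)) :
    (2 * oscBound p C ν q) ^ (p * s / (p - n + s)) ≤ (2 * C) ^ (p * s / (p - n + s)) *
      (((2 ^ q.1)⁻¹ : ℝ) ^ s + ν.real (dyadicCube q.1 q.2)) := by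
  have hp : 0 < p := (Nat.cast_nonneg n).trans_lt hn
  have hpn : 0 < p - n := sub_pos.2 hn
  have hpn' : p - n + s ≠ 0 := by positivity
  set t := p * s / (p - n + s) with ht
  have htp : t / p = s / (p - n + s) := by rw [ht]; field_simp
  have hw : (p - n) / (p - n + s) + t / p = 1 := by rw [htp]; field_simp
  have hexp : (1 - n / p) * t = s * ((p - n) / (p - n + s)) := by rw [ht]; field_simp
  rw [two_mul_oscBound_rpow hC, hexp, Real.rpow_mul (by positivity), mul_assoc]
  gcongr
  have h1 : (p - n) / (p - n + s) ≤ 1 := by rw [div_le_one (by positivity)]; linarith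
  have h2 : t / p ≤ 1 := by rw [htp, div_le_one (by positivity)]; linarith
  refine (Real.geom_mean_le_arith_mean2_weighted (by positivity) (by positivity) (by positivity)
    (by positivity) hw).trans ?_
  exact add_le_add (mul_le_of_le_one_left (by positivity) h1)
    (mul_le_of_le_one_left (by positivity) h2)

theorem HasInterCover.image [Nonempty (Fin N)] {θ : ℝ} (hθ0 : 0 < θ) (hθ1 : θ < 1) (hp : n < p)
    {E : Set (EuclideanSpace ℝ (Fin n))} (hE : Bornology.IsBounded E)
    {f : EuclideanSpace ℝ (Fin n) → EuclideanSpace ℝ (Fin N)}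
    {ν : Measure (EuclideanSpace ℝ (Fin n))} [IsFiniteMeasure ν] {C : ℝ} {l : ℕ} (hC : 0 ≤ C)
    (hf : ∀ k ≥ l, ∀ x ∈ E, ∀ y ∈ E, dyadicIndex k y = dyadicIndex k x →
      dist (f y) (f x) ≤ oscBound p C ν (k, dyadicIndex k x))
    (hs : HasInterCover θ E s) : HasInterCover θ (f '' E) (p * s / (p - n + s)) := by
  classical
  have hp0 : 0 < p := (Nat.cast_nonneg n).trans_lt hp
  have hpn : 0 < p - n := sub_pos.2 hp
  have hs0 := hs.1
  set t := p * s / (p - n + s) with ht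
  have ht0 : 0 < t := by positivity
  obtain ⟨C₁, δ₁, hδ₁, hcov⟩ := hs.exists_dyadic
  set M := 2 ^ n * ((2 * C) ^ p * ν.real univ) / (1 - 2⁻¹ ^ (p - n)) with hM
  have hM0 : 0 ≤ M := by
    have : (2 : ℝ)⁻¹ ^ (p - n) ≤ 1 :=
      Real.rpow_le_one (by norm_num) (by norm_num) hpn.le
    have : 0 ≤ 1 - (2 : ℝ)⁻¹ ^ (p - n) := sub_nonneg.2 this
    positivity
  refine HasInterCover.of_closedBall (ι := ℕ × (Fin n → ℤ)) ht0
    ((2 * C) ^ t * (C₁ + ν.real univ) + C₁ + M * 2 ^ (p - n))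
    (δ₀ := (min (min δ₁ (2 * 2 ^ l)⁻¹) 1) ^ (s / t)) (by positivity) fun η hη hηδ => ?_
  set δ := η ^ (t / s) with hδ
  have hδ0 : 0 < δ := by positivity
  have hδlt : δ < min (min δ₁ (2 * 2 ^ l)⁻¹) 1 := by
    have := Real.rpow_lt_rpow hη.le hηδ (show 0 < t / s by positivity)
    rwa [← Real.rpow_mul (by positivity), div_mul_div_cancel₀ ht0.ne', div_self hs0.ne',
      Real.rpow_one] at this
  have hη1 : η < 1 := hηδ.trans_le (Real.rpow_le_one (by positivity) (min_le_right _ _)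
    (by positivity))
  have hδη (a : ℝ) : δ ^ (s * a) = η ^ (t * a) := by
    rw [hδ, ← Real.rpow_mul hη.le]; congr 1; field_simp
  obtain ⟨hδδ₁, hδl⟩ := lt_min_iff.1 (lt_min_iff.1 hδlt).1
  obtain ⟨F, hEF, hF, hsum⟩ := hcov δ hδ0 hδδ₁
  obtain ⟨k₀, hk₀, hk₀'⟩ := exists_dyadic_near hδ0 (lt_min_iff.1 hδlt).2.le
  have hlk₀ : l ≤ k₀ := by
    refine le_of_inv_two_pow_lt (hk₀'.trans ?_)
    rw [mul_inv] at hδl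
    have : (0 : ℝ) < (2 ^ l)⁻¹ := by positivity
    linarith
  have hFk₀ (q) (hq : q ∈ F) : k₀ ≤ q.1 :=
    le_of_inv_two_pow_lt ((hF q hq).2.trans_le (by linarith))
  obtain ⟨G₂, hG₂, hG₂', hG₂card⟩ := exists_children_of_bad (ν := ν) hp0 hp hC hη hE k₀
  let G₁ : Finset (ℕ × (Fin n → ℤ)) := F.filter fun q => 2 * oscBound p C ν q ≤ η ∧
    ∃ x, dyadicIndex q.1 x = q.2 ∧ ∀ j < q.1, (j, dyadicIndex j x) ∉ F
  have hG₁F : G₁ ⊆ F := Finset.filter_subset _ _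
  have hgood (q) (hq : q ∈ G₁ ∪ G₂) : 2 * oscBound p C ν q ≤ η := by
    rcases Finset.mem_union.1 hq with hq | hq
    · exact (Finset.mem_filter.1 hq).2.1
    · exact (hG₂ q hq).2
  have hηθ : η ^ (1 / θ) ≤ η := by
    conv_rhs => rw [← Real.rpow_one η]
    exact Real.rpow_le_rpow_of_exponent_ge hη hη1.le ((one_le_div hθ0).2 hθ1.le)
  have hr (q) : 2 * max (oscBound p C ν q) (η ^ (1 / θ) / 2) =
      max (2 * oscBound p C ν q) (η ^ (1 / θ)) := by
    rw [mul_max_of_nonneg _ _ zero_le_two, mul_div_cancel₀ _ two_ne_zero]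
  refine ⟨G₁ ∪ G₂, fun q => f (dyadicPoint E q),
    fun q => max (oscBound p C ν q) (η ^ (1 / θ) / 2), ?_, fun q hq => ?_, ?_⟩
  · rintro _ ⟨x, hx, rfl⟩
    have hdist (k) (hk : k₀ ≤ k) :
        dist (f x) (f (dyadicPoint E (k, dyadicIndex k x))) ≤
          max (oscBound p C ν (k, dyadicIndex k x)) (η ^ (1 / θ) / 2) := by
      have hP := dyadicPoint_spec hx k
      refine le_max_of_le_left ?_
      rw [dist_comm]
      exact hf k (hlk₀.trans hk) x hx _ hP.1 hP.2
    have hk := Nat.find_spec (hEF x hx)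
    set k := Nat.find (hEF x hx)
    have hkk₀ : k₀ ≤ k := hFk₀ _ hk
    by_cases hg : 2 * oscBound p C ν (k, dyadicIndex k x) ≤ η
    · refine ⟨_, Finset.mem_union_left _ (Finset.mem_filter.2 ⟨hk, hg, x, rfl, fun j hj => ?_⟩),
        hdist k hkk₀⟩
      exact Nat.find_min (hEF x hx) hj
    · have hex : ∃ j, 2 * oscBound p C ν (k + j, dyadicIndex (k + j) x) ≤ η := by
        obtain ⟨K, hK⟩ := exists_forall_two_mul_oscBound_le (ν := ν) hp0 hp hC hη
        exact ⟨K, hK _ (by omega) _⟩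
      have hj := Nat.find_spec hex
      have hjmin := fun i => Nat.find_min hex (m := i)
      generalize Nat.find hex = j at hj hjmin
      cases j with
      | zero => exact absurd hj hg
      | succ j =>
        refine ⟨_, Finset.mem_union_right _ (hG₂' x hx (k + j) (by omega) ?_ hj),
          hdist _ (by omega)⟩
        exact not_le.1 (hjmin j j.lt_succ_self)
  · rw [hr]
    exact ⟨le_max_right _ _, max_le (hgood q hq) hηθ⟩
  · simp only [hr]
    have hpos (q : ℕ × (Fin n → ℤ)) : 0 ≤ max (2 * oscBound p C ν q) (η ^ (1 / θ)) :=
      le_max_of_le_right (by positivity)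
    refine (sum_union_le_of_nonneg fun q => Real.rpow_nonneg (hpos q) t).trans (add_le_add ?_ ?_)
    · have hC₁ : ∑ q ∈ G₁, ((2 ^ q.1)⁻¹ : ℝ) ^ s ≤ C₁ :=
        (Finset.sum_le_sum_of_subset_of_nonneg hG₁F fun q _ _ => by positivity).trans hsum
      have hd : (G₁ : Set (ℕ × (Fin n → ℤ))).PairwiseDisjoint fun q => dyadicCube q.1 q.2 :=
        pairwiseDisjoint_of_maximal (F := F) (by exact_mod_cast hG₁F)
          fun q hq => (Finset.mem_filter.1 (Finset.mem_coe.1 hq)).2.2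
      calc _ ≤ ∑ q ∈ G₁, ((2 * C) ^ t * (((2 ^ q.1)⁻¹ : ℝ) ^ s + ν.real (dyadicCube q.1 q.2)) +
              ((2 ^ q.1)⁻¹ : ℝ) ^ s) := by
            refine Finset.sum_le_sum fun q hq => ?_
            have h1 := two_mul_oscBound_rpow_le hp hs0 hC ν q
            have h2 : (η ^ (1 / θ)) ^ t ≤ ((2 ^ q.1)⁻¹ : ℝ) ^ s := by
              rw [← Real.rpow_mul hη.le, mul_comm, ← hδη, mul_comm, Real.rpow_mul hδ0.le]
              exact Real.rpow_le_rpow (by positivity) (hF q (hG₁F hq)).1 hs0.le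
            have hb := oscBound_nonneg (p := p) (ν := ν) hC q
            rcases max_choice (2 * oscBound p C ν q) (η ^ (1 / θ)) with h | h <;> rw [h]
            · exact h1.trans (le_add_of_nonneg_right (by positivity))
            · exact h2.trans (le_add_of_nonneg_left (by positivity))
        _ = (2 * C) ^ t * (∑ q ∈ G₁, ((2 ^ q.1)⁻¹ : ℝ) ^ s +
              ∑ q ∈ G₁, ν.real (dyadicCube q.1 q.2)) + ∑ q ∈ G₁, ((2 ^ q.1)⁻¹ : ℝ) ^ s := by
            rw [Finset.sum_add_distrib, ← Finset.mul_sum, Finset.sum_add_distrib]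
        _ ≤ _ := by
            gcongr
            exact sum_measureReal_dyadicCube_le ν hd
    · have hexp : (t / s) * (p - n) + t = p := by rw [ht]; field_simp
      calc _ ≤ ∑ q ∈ G₂, η ^ t := by
            refine Finset.sum_le_sum fun q hq => ?_
            exact Real.rpow_le_rpow (hpos q) (max_le (hG₂ q hq).2 hηθ) ht0.le
        _ = (G₂.card * η ^ p) * η ^ (t - p) := by
            rw [Finset.sum_const, nsmul_eq_mul, mul_assoc, ← Real.rpow_add hη]
            congr 2; ring
        _ ≤ (M * (2 * δ) ^ (p - n)) * η ^ (t - p) := by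
            refine mul_le_mul_of_nonneg_right (hG₂card.trans ?_) (by positivity)
            exact mul_le_mul_of_nonneg_left
              (Real.rpow_le_rpow (by positivity) hk₀'.le hpn.le) hM0
        _ = M * 2 ^ (p - n) * η ^ ((t / s) * (p - n) + (t - p)) := by
            rw [Real.mul_rpow zero_le_two hδ0.le, Real.rpow_add hη, hδ, ← Real.rpow_mul hη.le]
            ring
        _ = _ := by
            rw [show (t / s) * (p - n) + (t - p) = 0 by linarith, Real.rpow_zero, mul_one]

end Distortion

theorem interDim_empty {X : Type*} [MetricSpace X] (θ : ℝ) : interDim θ (∅ : Set X) = 0 := by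
  refine le_antisymm (le_of_forall_pos_le_add fun ε hε => ?_) (interDim_nonneg _ _)
  rw [zero_add]
  refine HasInterCover.interDim_le ⟨hε, 1, one_pos, 1, one_pos, fun δ _ _ => ⟨∅, fun _ => ∅, ?_⟩⟩
  simp

theorem interDim_of_subsingleton {X : Type*} [MetricSpace X] [Subsingleton X] (θ : ℝ) (E : Set X) :
    interDim θ E = 0 := by
  rcases E.eq_empty_or_nonempty with rfl | ⟨x, hx⟩
  · exact interDim_empty θ
  rw [interDim_eq_sInf]
  convert Real.sInf_empty
  refine eq_empty_of_forall_notMem fun s hs => ?_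
  obtain ⟨-, C, -, δ₀, hδ₀, h⟩ := hs
  obtain ⟨J, A, hE, hA, -⟩ := h (δ₀ / 2) (by positivity) (by linarith)
  obtain ⟨i, hi, -⟩ := mem_iUnion₂.1 (hE hx)
  have := (Real.rpow_pos_of_pos (half_pos hδ₀) _).trans_le (hA i hi).1
  rw [diam_subsingleton subsingleton_of_subsingleton] at this
  exact this.false

/-- Fraser–Tyson: distortion of the upper `θ`-intermediate dimension by continuous
supercritical Sobolev maps. -/
theorem ft_intermediate_dim_distortion (n N : ℕ) (hn : 2 ≤ n)
    (Ω : Set (EuclideanSpace ℝ (Fin n))) (hΩ : IsEuclDomain Ω)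
    (p : ℝ) (hp : (n : ℝ) < p)
    (f : EuclideanSpace ℝ (Fin n) → EuclideanSpace ℝ (Fin N))
    (hfc : ContinuousOn f Ω) (hf : MemW1p n N p Ω f)
    (E : Set (EuclideanSpace ℝ (Fin n))) (hEc : IsCompact E) (hE : E ⊆ Ω)
    (θ : ℝ) (hθ0 : 0 < θ) (hθ1 : θ < 1) :
    interDim θ (f '' E) ≤ p * interDim θ E / (p - n + interDim θ E) := by
  have hpn : 0 < p - n := sub_pos.2 hp
  have hp0 : 0 < p := (Nat.cast_nonneg n).trans_lt hp
  have hd := interDim_nonneg θ E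
  rcases isEmpty_or_nonempty (Fin N) with _ | _
  · rw [interDim_of_subsingleton]
    positivity
  obtain ⟨ν, _, C, l, hC, hosc⟩ := hf.exists_dist_le (by omega) hΩ.1 hp hfc hEc hE
  have hle (s : ℝ) (hs : HasInterCover θ E s) : interDim θ (f '' E) ≤ p * s / (p - n + s) :=
    (hs.image hθ0 hθ1 hp hEc.isBounded hC hosc).interDim_le
  have hcont : ContinuousAt (fun s : ℝ => p * s / (p - n + s)) (interDim θ E) :=
    ContinuousAt.div (by fun_prop) (by fun_prop) (by positivity)
  obtain ⟨u, -, hu, huE⟩ := exists_seq_tendsto_sInf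
    (⟨n, hasInterCover_of_isBounded (by omega) hθ0 hθ1 hEc.isBounded⟩ :
      {s | HasInterCover θ E s}.Nonempty) ⟨0, fun _ hs => hs.1.le⟩
  exact ge_of_tendsto' (hcont.tendsto.comp hu) fun i => hle _ (huE i)
end
end
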